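/- Let n ≥ 2, let j ≥ 0 be an integer, and let μ ∈ (2j, 2j + 1). If u is a μ-homogeneous solution of the thin obstacle problem in ℝⁿ whose gradient extends continuously from the open half-space {x_n > 0} to {x_n ≥ 0} \ {0}, then u is identically zero. In particular, there are no nontrivial μ-homogeneous solutions of the thin obstacle problem in ℝⁿ with μ in the union over j ≥ 0 of the intervals (2j, 2j+1). -/

import Mathlib

open Real Set Filter

/-- Partial derivative of `f : ℝⁿ → ℝ` in the `i`-th coordinate direction. -/
noncomputable def pd {n : ℕ} (i : Fin n) (f : (Fin n → ℝ) → ℝ) (x : Fin n → ℝ) : ℝ :=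
  fderiv ℝ f x (Pi.single i 1)

/-- The Laplacian of `f : ℝⁿ → ℝ`. -/
noncomputable def lap {n : ℕ} (f : (Fin n → ℝ) → ℝ) (x : Fin n → ℝ) : ℝ :=
  ∑ i, pd i (pd i f) x

/-- The contact set `Z(u) = {xᵢ = 0} ∩ {u = 0}`, `i` being the distinguished coordinate. -/
def contactSet {n : ℕ} (u : (Fin n → ℝ) → ℝ) (i : Fin n) : Set (Fin n → ℝ) :=
  {x | x i = 0 ∧ u x = 0}

/-- `d` is the one-sided derivative `∂ᵢ⁺u(x) = lim_{t→0⁺} (u(x+t eᵢ) - u(x))/t`. -/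
def HasUpperDeriv {n : ℕ} (u : (Fin n → ℝ) → ℝ) (i : Fin n) (x : Fin n → ℝ) (d : ℝ) : Prop :=
  Filter.Tendsto (fun t : ℝ => (u (x + t • (Pi.single i 1 : Fin n → ℝ)) - u x) / t)
    (nhdsWithin 0 (Set.Ioi 0)) (nhds d)

/-- `u` is a `μ`-homogeneous solution of the thin obstacle problem in `ℝⁿ`,
with thin space `{xᵢ = 0}`. -/
structure IsTOPSol {n : ℕ} (μ : ℝ) (u : (Fin n → ℝ) → ℝ) (i : Fin n) : Prop where
  cont : Continuous u
  symm : ∀ x, u (Function.update x i (-(x i))) = u x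
  homog : ∀ r : ℝ, 0 < r → ∀ x, u (r • x) = r ^ μ * u x
  smooth : ContDiffOn ℝ 2 u (contactSet u i)ᶜ
  harm : ∀ x ∈ (contactSet u i)ᶜ, lap u x = 0
  nonneg : ∀ x, x i = 0 → 0 ≤ u x
  upper : ∀ x, x i = 0 → ∃ d, d ≤ 0 ∧ HasUpperDeriv u i x d

section Helpers

open MeasureTheory

/-- The half-space. -/
def hsp (d : ℕ) : Set (Fin (d + 2) → ℝ) := {x | 0 < x (Fin.last (d + 1))}

lemma isOpen_hsp (d : ℕ) : IsOpen (hsp d) :=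
  isOpen_lt continuous_const (continuous_apply _)

lemma integral_pd_eq_zero {n : ℕ} (f : (Fin n → ℝ) → ℝ) (hf : ContDiff ℝ 1 f)
    (hc : HasCompactSupport f) (i : Fin n) : ∫ x, pd i f x = 0 := by
  have h1 : Continuous (fun x => pd i f x) :=
    (hf.continuous_fderiv one_ne_zero).clm_apply continuous_const
  have h2 : HasCompactSupport (fun x => pd i f x) := hc.fderiv_apply ℝ _
  have := integral_mul_fderiv_eq_neg_fderiv_mul_of_integrable (μ := volume)
    (f := fun _ : Fin n → ℝ => (1:ℝ)) (g := f) (v := Pi.single i 1)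
    (by simp) (by simpa [pd] using h1.integrable_of_hasCompactSupport h2)
    (by simpa using hf.continuous.integrable_of_hasCompactSupport hc)
    (by simp) (fun x _ => (hf.differentiable one_ne_zero) x)
  simpa [pd] using this

/-- smooth cutoff: zero for `s ≤ 1`, one for `s ≥ 2`. -/
noncomputable def tcut (s : ℝ) : ℝ := Real.smoothTransition (s - 1)

lemma tcut_contDiff : ContDiff ℝ 1 tcut :=
  Real.smoothTransition.contDiff (n := 1) |>.comp (contDiff_id.sub contDiff_const)

lemma tcut_nonneg (s : ℝ) : 0 ≤ tcut s := Real.smoothTransition.nonneg _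
lemma tcut_le_one (s : ℝ) : tcut s ≤ 1 := Real.smoothTransition.le_one _
lemma tcut_zero {s : ℝ} (h : s ≤ 1) : tcut s = 0 :=
  Real.smoothTransition.zero_of_nonpos (by linarith)
lemma tcut_one {s : ℝ} (h : 2 ≤ s) : tcut s = 1 :=
  Real.smoothTransition.one_of_one_le (by linarith)

lemma tcut_deriv_cont : Continuous (deriv tcut) := tcut_contDiff.continuous_deriv le_rfl

lemma tcut_deriv_zero {s : ℝ} (h : s < 1) : deriv tcut s = 0 := by
  have : tcut =ᶠ[nhds s] fun _ => (0:ℝ) := by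
    filter_upwards [Iio_mem_nhds h] with x hx using tcut_zero (le_of_lt hx)
  rw [this.deriv_eq]; simp

lemma tcut_deriv_zero' {s : ℝ} (h : 2 < s) : deriv tcut s = 0 := by
  have : tcut =ᶠ[nhds s] fun _ => (1:ℝ) := by
    filter_upwards [Ioi_mem_nhds h] with x hx using tcut_one (le_of_lt hx)
  rw [this.deriv_eq]; simp

lemma tcut_deriv_supp : HasCompactSupport (deriv tcut) := by
  apply HasCompactSupport.intro (isCompact_Icc (a := (1:ℝ)) (b := 2))
  intro x hx
  simp only [Set.mem_Icc, not_and_or, not_le] at hx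
  rcases hx with h | h
  · exact tcut_deriv_zero h
  · exact tcut_deriv_zero' h

lemma tcut_deriv_integrable : Integrable (deriv tcut) :=
  tcut_deriv_cont.integrable_of_hasCompactSupport tcut_deriv_supp

lemma tcut_deriv_integral : ∫ s, deriv tcut s = 1 := by
  have h1 : ∫ s, deriv tcut s = ∫ s in (0:ℝ)..3, deriv tcut s := by
    rw [intervalIntegral.integral_of_le (by norm_num)]
    symm
    apply setIntegral_eq_integral_of_forall_compl_eq_zero
    intro x hx
    simp only [Set.mem_Ioc, not_and_or, not_le, not_lt] at hx
    rcases hx with h | h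
    · exact tcut_deriv_zero (by linarith)
    · exact tcut_deriv_zero' (by linarith)
  rw [h1, intervalIntegral.integral_deriv_eq_sub
    (fun x _ => (tcut_contDiff.differentiable one_ne_zero) x)
    (tcut_deriv_cont.intervalIntegrable _ _), tcut_one (by norm_num), tcut_zero (by norm_num)]
  norm_num

/-- A fixed bump function on `ℝⁿ`. -/
noncomputable def bmp (n : ℕ) : ContDiffBump (0 : Fin n → ℝ) := ⟨1, 2, by norm_num, by norm_num⟩

lemma bmp_pd_bound (n : ℕ) : ∃ C : ℝ, 0 ≤ C ∧ ∀ i x, |pd i (bmp n) x| ≤ C := by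
  have hc : HasCompactSupport (bmp n) := (bmp n).hasCompactSupport
  have hd : ContDiff ℝ 1 (bmp n) := (bmp n).contDiff
  have : ∀ i, ∃ C, ∀ x, ‖pd i (bmp n) x‖ ≤ C := fun i =>
    ((hd.continuous_fderiv one_ne_zero).clm_apply continuous_const).bounded_above_of_compact_support
      (hc.fderiv_apply ℝ _)
  choose C hC using this
  refine ⟨∑ i, |C i|, Finset.sum_nonneg fun i _ => abs_nonneg _, fun i x => ?_⟩
  exact ((hC i x).trans (le_abs_self _)).trans
    (Finset.single_le_sum (f := fun i => |C i|) (fun i _ => abs_nonneg _) (Finset.mem_univ i))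

/-- cutoff function -/
noncomputable def cutf (d : ℕ) (c : ℝ) (x : Fin (d + 2) → ℝ) : ℝ :=
  tcut (c * x (Fin.last (d + 1))) * bmp (d + 2) (c⁻¹ • x)

lemma cutf_contDiff (d : ℕ) (c : ℝ) : ContDiff ℝ 1 (cutf d c) := by
  refine ContDiff.mul (tcut_contDiff.comp (contDiff_const.mul (contDiff_apply _ _ _))) ?_
  exact (bmp (d+2)).contDiff.comp (contDiff_const_smul c⁻¹)

lemma cutf_pd (d : ℕ) (c : ℝ) (x : Fin (d + 2) → ℝ) (i : Fin (d + 2)) :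
    pd i (cutf d c) x =
      (if i = Fin.last (d + 1) then c * deriv tcut (c * x (Fin.last (d + 1))) else 0) *
        bmp (d + 2) (c⁻¹ • x) +
      tcut (c * x (Fin.last (d + 1))) * (c⁻¹ * pd i (bmp (d + 2)) (c⁻¹ • x)) := by
  have h1 : HasFDerivAt (fun x : Fin (d+2) → ℝ => tcut (c * x (Fin.last (d + 1))))
      (deriv tcut (c * x (Fin.last (d + 1))) •
        (c • (ContinuousLinearMap.proj (Fin.last (d+1)) : (Fin (d+2) → ℝ) →L[ℝ] ℝ))) x := by
    have ha : HasFDerivAt (fun x : Fin (d+2) → ℝ => c * x (Fin.last (d + 1)))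
      (c • (ContinuousLinearMap.proj (Fin.last (d+1)) : (Fin (d+2) → ℝ) →L[ℝ] ℝ)) x :=
      (hasFDerivAt_apply (𝕜 := ℝ) (Fin.last (d+1)) x).const_mul c
    exact ((tcut_contDiff.differentiable one_ne_zero) _).hasDerivAt.comp_hasFDerivAt x ha
  have h2 : HasFDerivAt (fun x : Fin (d+2) → ℝ => bmp (d + 2) (c⁻¹ • x))
      ((fderiv ℝ (bmp (d+2)) (c⁻¹ • x)).comp (c⁻¹ • ContinuousLinearMap.id ℝ _)) x := by
    have hd : ContDiff ℝ 1 (bmp (d+2)) := (bmp (d+2)).contDiff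
    exact HasFDerivAt.comp (g := fun y => bmp (d + 2) y) (f := fun x => c⁻¹ • x) x
      ((hd.differentiable one_ne_zero) (c⁻¹ • x)).hasFDerivAt
      ((hasFDerivAt_id x).const_smul c⁻¹)
  have h3 := h1.mul h2
  have h4 : fderiv ℝ (cutf d c) x = _ := h3.fderiv
  rw [pd, h4]
  simp only [add_apply, smul_apply, smul_eq_mul,
    ContinuousLinearMap.comp_apply, ContinuousLinearMap.proj_apply, ContinuousLinearMap.id_apply,
    map_smul, pd, Pi.single_apply]
  by_cases h : i = Fin.last (d+1)
  · subst h; simp; ring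
  · simp [h, Ne.symm h]

lemma bmp_eventually_one {n : ℕ} (x : Fin n → ℝ) :
    ∀ᶠ m : ℕ in atTop, bmp n (((m : ℝ) + 1)⁻¹ • x) = 1 := by
  filter_upwards [tendsto_natCast_atTop_atTop.eventually_ge_atTop ‖x‖] with m hm
  apply (bmp n).one_of_mem_closedBall
  have hpos : (0:ℝ) < (m:ℝ) + 1 := by positivity
  rw [mem_closedBall_zero_iff, norm_smul, norm_inv, Real.norm_of_nonneg hpos.le]
  rw [inv_mul_le_iff₀ hpos]
  have : (bmp n).rIn = 1 := rfl
  rw [this]; linarith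

lemma cutf_eventually_one {d : ℕ} {x : Fin (d+2) → ℝ} (hx : x ∈ hsp d) :
    ∀ᶠ m : ℕ in atTop, cutf d ((m : ℝ) + 1) x = 1 := by
  have hx' : 0 < x (Fin.last (d+1)) := hx
  filter_upwards [bmp_eventually_one x,
    tendsto_natCast_atTop_atTop.eventually_ge_atTop (2 / x (Fin.last (d+1)))] with m h1 h2
  rw [cutf, h1, tcut_one, one_mul]
  rw [div_le_iff₀ hx'] at h2
  nlinarith

lemma cutf_zero_of_le {d : ℕ} {c : ℝ} {x : Fin (d+2) → ℝ} (h : c * x (Fin.last (d+1)) ≤ 1) :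
    cutf d c x = 0 := by
  rw [cutf, tcut_zero h, zero_mul]

lemma cutf_abs_le {d : ℕ} {c : ℝ} {x : Fin (d+2) → ℝ} : |cutf d c x| ≤ 1 := by
  rw [cutf, abs_of_nonneg (mul_nonneg (tcut_nonneg _) (bmp _).nonneg)]
  exact mul_le_one₀ (tcut_le_one _) (bmp _).nonneg (bmp _).le_one

/-- Cut-off version of the divergence theorem. -/
lemma div_cut {d : ℕ} (F : Fin (d + 2) → (Fin (d + 2) → ℝ) → ℝ) (D : (Fin (d + 2) → ℝ) → ℝ)
    (hF : ∀ i, ContDiffOn ℝ 1 (F i) (hsp d))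
    (hD : ∀ x ∈ hsp d, ∑ i, pd i (F i) x = D x) (c : ℝ) (hc : 0 < c) :
    ∫ x in hsp d, (cutf d c x * D x + ∑ i, F i x * pd i (cutf d c) x) = 0 := by
  set g : Fin (d+2) → (Fin (d+2) → ℝ) → ℝ := fun i x => cutf d c x * F i x with hg
  have hloc : ∀ x : Fin (d+2) → ℝ, x ∉ hsp d → ∀ i, g i =ᶠ[nhds x] fun _ => 0 := by
    intro x hx i
    have hx' : x (Fin.last (d+1)) ≤ 0 := not_lt.1 hx
    have : {y : Fin (d+2) → ℝ | c * y (Fin.last (d+1)) < 1} ∈ nhds x := by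
      apply IsOpen.mem_nhds
      · exact isOpen_lt (continuous_const.mul (continuous_apply _)) continuous_const
      · show c * x (Fin.last (d+1)) < 1
        nlinarith
    filter_upwards [this] with y hy
    simp only [hg]
    rw [cutf_zero_of_le (le_of_lt hy), zero_mul]
  have hgd : ∀ i, ContDiff ℝ 1 (g i) := by
    intro i
    rw [contDiff_iff_contDiffAt]
    intro x
    by_cases hx : x ∈ hsp d
    · exact (cutf_contDiff d c).contDiffAt.mul ((hF i).contDiffAt ((isOpen_hsp d).mem_nhds hx))
    · exact contDiffAt_const.congr_of_eventuallyEq (hloc x hx i)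
  have hgc : ∀ i, HasCompactSupport (g i) := by
    intro i
    apply HasCompactSupport.intro (isCompact_closedBall (0 : Fin (d+2) → ℝ) (2 * c))
    intro x hx
    have : bmp (d+2) (c⁻¹ • x) = 0 := by
      apply (bmp (d+2)).zero_of_le_dist
      rw [mem_closedBall_zero_iff, not_le] at hx
      rw [dist_zero_right, norm_smul, norm_inv, Real.norm_of_nonneg hc.le, le_inv_mul_iff₀ hc]
      have : (bmp (d+2)).rOut = 2 := rfl
      rw [this]; linarith
    simp [hg, cutf, this]
  have hpc : ∀ i, Integrable (fun x => pd i (g i) x) := fun i =>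
    (((hgd i).continuous_fderiv one_ne_zero).clm_apply continuous_const).integrable_of_hasCompactSupport
      ((hgc i).fderiv_apply ℝ _)
  have h0 : ∫ x, ∑ i, pd i (g i) x = 0 := by
    rw [integral_finsetSum _ (fun i _ => hpc i)]
    exact Finset.sum_eq_zero fun i _ => integral_pd_eq_zero _ (hgd i) (hgc i) i
  rw [← h0, ← integral_indicator (isOpen_hsp d).measurableSet]
  congr 1
  ext x
  by_cases hx : x ∈ hsp d
  · rw [Set.indicator_of_mem hx, ← hD x hx, Finset.mul_sum, ← Finset.sum_add_distrib]
    refine Finset.sum_congr rfl fun i _ => ?_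
    have h1 : DifferentiableAt ℝ (cutf d c) x := (cutf_contDiff d c).differentiable one_ne_zero x
    have h2 : DifferentiableAt ℝ (F i) x :=
      ((hF i).contDiffAt ((isOpen_hsp d).mem_nhds hx)).differentiableAt one_ne_zero
    have h3 := (h1.hasFDerivAt.mul h2.hasFDerivAt).fderiv
    have h4 : pd i (g i) x = _ := congrArg (fun L => L (Pi.single i 1)) h3
    rw [h4]
    simp [pd]
  · rw [Set.indicator_of_notMem hx]
    symm
    refine Finset.sum_eq_zero fun i _ => ?_
    rw [pd, (hloc x hx i).fderiv_eq]
    simp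

/-- insertion of last coordinate -/
def ins {d : ℕ} (t : ℝ) (y : Fin (d + 1) → ℝ) : Fin (d + 2) → ℝ :=
  Fin.insertNth (Fin.last (d + 1)) t y

lemma ins_last {d : ℕ} (t : ℝ) (y : Fin (d + 1) → ℝ) : ins t y (Fin.last (d+1)) = t := by
  simp [ins]

lemma ins_castSucc {d : ℕ} (t : ℝ) (y : Fin (d + 1) → ℝ) (i : Fin (d + 1)) :
    ins t y i.castSucc = y i := by
  have := Fin.insertNth_apply_succAbove (α := fun _ => ℝ) (Fin.last (d+1)) t y i
  rwa [Fin.succAbove_last] at this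

lemma ins_cont {d : ℕ} : Continuous (fun p : ℝ × (Fin (d + 1) → ℝ) => ins p.1 p.2) := by
  refine continuous_pi fun i => ?_
  refine Fin.lastCases ?_ (fun i => ?_) i
  · simp only [ins_last]; exact continuous_fst
  · simp only [ins_castSucc]; exact (continuous_apply i).comp continuous_snd

lemma ins_meas {d : ℕ} : Measurable (fun p : ℝ × (Fin (d + 1) → ℝ) => ins p.1 p.2) :=
  (MeasurableEquiv.piFinSuccAbove (fun _ => ℝ) (Fin.last (d+1))).symm.measurable

lemma ins_mp (d : ℕ) : MeasurePreserving (fun p : ℝ × (Fin (d + 1) → ℝ) => ins p.1 p.2) :=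
  (volume_preserving_piFinSuccAbove (fun _ => ℝ) (Fin.last (d+1))).symm

lemma integral_ins {d : ℕ} (g : (Fin (d + 2) → ℝ) → ℝ) :
    ∫ x, g x = ∫ p : ℝ × (Fin (d + 1) → ℝ), g (ins p.1 p.2) :=
  ((volume_preserving_piFinSuccAbove (fun _ => ℝ) (Fin.last (d+1))).symm.integral_comp
    (MeasurableEquiv.measurableEmbedding _) g).symm

lemma integrable_ins {d : ℕ} {g : (Fin (d + 2) → ℝ) → ℝ} (h : Integrable g) :
    Integrable (fun p : ℝ × (Fin (d + 1) → ℝ) => g (ins p.1 p.2)) :=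
  (ins_mp d).integrable_comp_of_integrable h

/-- boundary layer limit -/
lemma layer_limit {d : ℕ} (f : (Fin (d + 2) → ℝ) → ℝ) (F0 b : (Fin (d + 1) → ℝ) → ℝ)
    (hf : Measurable f) (hfi : Integrable f)
    (hb : Integrable b) (hfb : ∀ᵐ y, ∀ t > 0, |f (ins t y)| ≤ b y)
    (hlim : ∀ᵐ y, Tendsto (fun t => f (ins t y)) (nhdsWithin 0 (Set.Ioi 0)) (nhds (F0 y))) :
    Tendsto (fun m : ℕ => ∫ x, f x * (((m:ℝ) + 1) * deriv tcut (((m:ℝ) + 1) * x (Fin.last (d+1))) *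
      bmp (d+2) (((m:ℝ) + 1)⁻¹ • x))) atTop (nhds (∫ y, F0 y)) := by
  obtain ⟨K, hK⟩ : ∃ K, ∀ s, ‖deriv tcut s‖ ≤ K :=
    tcut_deriv_cont.bounded_above_of_compact_support tcut_deriv_supp
  set R : ℕ → (Fin (d+1) → ℝ) → ℝ := fun m y => ∫ s, deriv tcut s *
    (f (ins (s / ((m:ℝ)+1)) y) * bmp (d+2) (((m:ℝ) + 1)⁻¹ • (ins (s / ((m:ℝ)+1)) y))) with hR
  have hbc : Continuous (bmp (d+2)) := (bmp (d+2)).continuous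
  have hbm : ∀ m : ℕ, Measurable (fun x : Fin (d+2) → ℝ => bmp (d+2) (((m:ℝ) + 1)⁻¹ • x)) :=
    fun m => (hbc.comp (continuous_const_smul _)).measurable
  have hmeas : ∀ m : ℕ, Measurable (fun x : Fin (d+2) → ℝ =>
      (((m:ℝ) + 1) * deriv tcut (((m:ℝ) + 1) * x (Fin.last (d+1))) *
      bmp (d+2) (((m:ℝ) + 1)⁻¹ • x))) := by
    intro m
    apply Continuous.measurable
    exact (continuous_const.mul (tcut_deriv_cont.comp
      (continuous_const.mul (continuous_apply _)))).mul (hbc.comp (continuous_const_smul _))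
  have hint : ∀ m : ℕ, Integrable (fun x => f x * (((m:ℝ) + 1) *
      deriv tcut (((m:ℝ) + 1) * x (Fin.last (d+1))) * bmp (d+2) (((m:ℝ) + 1)⁻¹ • x))) := by
    intro m
    refine hfi.mul_bdd (c := ((m:ℝ)+1) * K) (hmeas m).aestronglyMeasurable (ae_of_all _ fun x => ?_)
    rw [norm_mul, norm_mul, Real.norm_of_nonneg (by positivity : (0:ℝ) ≤ (m:ℝ)+1)]
    have h1 : ‖bmp (d+2) (((m:ℝ) + 1)⁻¹ • x)‖ ≤ 1 := by
      rw [Real.norm_of_nonneg (bmp _).nonneg]; exact (bmp _).le_one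
    have hK0 : 0 ≤ K := (norm_nonneg _).trans (hK 0)
    calc _ ≤ ((m:ℝ)+1) * K * 1 := by
          gcongr
          exact hK _
      _ = _ := by ring
  have hrw : ∀ m : ℕ, ∫ x, f x * (((m:ℝ) + 1) * deriv tcut (((m:ℝ) + 1) * x (Fin.last (d+1))) *
      bmp (d+2) (((m:ℝ) + 1)⁻¹ • x)) = ∫ y, R m y := by
    intro m
    have hc : (0:ℝ) < (m:ℝ) + 1 := by positivity
    rw [integral_ins]
    have h1 := integrable_ins (hint m)
    rw [Measure.volume_eq_prod] at h1 ⊢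
    rw [integral_prod_symm _ h1]
    congr 1; ext y
    simp only [hR, ins_last]
    have := Measure.integral_comp_mul_left (fun s => deriv tcut s *
      (f (ins (s / ((m:ℝ)+1)) y) * bmp (d+2) (((m:ℝ) + 1)⁻¹ • (ins (s / ((m:ℝ)+1)) y)))) ((m:ℝ)+1)
    rw [abs_of_pos (inv_pos.2 hc), smul_eq_mul, eq_inv_mul_iff_mul_eq₀ hc.ne'] at this
    rw [← this, ← integral_const_mul]
    congr 1; ext t
    rw [mul_div_cancel_left₀ _ hc.ne']
    ring
  have hRm : ∀ m, AEStronglyMeasurable (R m) volume := by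
    intro m
    have : Measurable (fun p : (Fin (d+1) → ℝ) × ℝ => deriv tcut p.2 *
      (f (ins (p.2 / ((m:ℝ)+1)) p.1) * bmp (d+2) (((m:ℝ) + 1)⁻¹ • (ins (p.2 / ((m:ℝ)+1)) p.1)))) := by
      have hi : Measurable (fun p : (Fin (d+1) → ℝ) × ℝ => ins (p.2 / ((m:ℝ)+1)) p.1) :=
        ins_meas.comp ((measurable_snd.div_const _).prodMk measurable_fst)
      exact (tcut_deriv_cont.measurable.comp measurable_snd).mul ((hf.comp hi).mul
        ((hbm m).comp hi))
    exact this.stronglyMeasurable.integral_prod_right.aestronglyMeasurable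
  have hbd : ∀ᵐ y, ∀ m : ℕ, ∀ s, ‖deriv tcut s *
    (f (ins (s / ((m:ℝ)+1)) y) * bmp (d+2) (((m:ℝ) + 1)⁻¹ • (ins (s / ((m:ℝ)+1)) y)))‖ ≤
      ‖deriv tcut s‖ * b y := by
    filter_upwards [hfb] with y hy m s
    rcases lt_or_ge s 1 with hs | hs
    · simp [tcut_deriv_zero hs]
    · rw [norm_mul, norm_mul]
      have h1 : ‖bmp (d+2) (((m:ℝ) + 1)⁻¹ • (ins (s / ((m:ℝ)+1)) y))‖ ≤ 1 := by
        rw [Real.norm_of_nonneg (bmp _).nonneg]; exact (bmp _).le_one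
      have h2 := hy (s / ((m:ℝ)+1)) (by positivity)
      rw [← Real.norm_eq_abs] at h2
      gcongr
      calc _ ≤ b y * 1 := mul_le_mul h2 h1 (norm_nonneg _) ((norm_nonneg _).trans h2)
        _ = b y := mul_one _
  simp_rw [hrw]
  refine tendsto_integral_of_dominated_convergence (fun y => (∫ s, ‖deriv tcut s‖) * b y) hRm
    (hb.const_mul _) ?_ ?_
  · intro m
    filter_upwards [hbd] with y hy
    rw [← integral_mul_const]
    exact norm_integral_le_of_norm_le (tcut_deriv_integrable.norm.mul_const _)
      (ae_of_all _ fun s => hy m s)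
  · filter_upwards [hbd, hlim] with y hy hl
    have e1 : F0 y = ∫ s, deriv tcut s * F0 y := by
      rw [integral_mul_const, tcut_deriv_integral, one_mul]
    rw [e1]
    refine tendsto_integral_of_dominated_convergence (fun s => ‖deriv tcut s‖ * b y) ?_
      (tcut_deriv_integrable.norm.mul_const _) (fun m => ae_of_all _ fun s => hy m s) ?_
    · intro m
      have hi : Measurable (fun s : ℝ => ins (s / ((m:ℝ)+1)) y) :=
        ins_meas.comp ((measurable_id.div_const _).prodMk measurable_const)
      exact (tcut_deriv_cont.measurable.mul ((hf.comp hi).mul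
        ((hbm m).comp hi))).aestronglyMeasurable
    · refine ae_of_all _ fun s => ?_
      rcases lt_or_ge s 1 with hs | hs
      · simp [tcut_deriv_zero hs]
      · refine Tendsto.const_mul _ ?_
        have hz : Tendsto (fun m : ℕ => s / ((m:ℝ)+1)) atTop (nhdsWithin 0 (Set.Ioi 0)) := by
          rw [tendsto_nhdsWithin_iff]
          refine ⟨?_, Eventually.of_forall fun m => ?_⟩
          · exact tendsto_const_nhds.div_atTop
              (tendsto_atTop_add_const_right _ _ tendsto_natCast_atTop_atTop)
          · show 0 < s / ((m:ℝ)+1)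
            positivity
        have h1 := hl.comp hz
        have h2 : Tendsto (fun m : ℕ => bmp (d+2) (((m:ℝ) + 1)⁻¹ • (ins (s / ((m:ℝ)+1)) y)))
            atTop (nhds 1) := by
          have hcont : Continuous (fun t : ℝ => ins t y) :=
            ins_cont.comp (continuous_id.prodMk continuous_const)
          have : Tendsto (fun m : ℕ => (((m:ℝ) + 1)⁻¹ • (ins (s / ((m:ℝ)+1)) y))) atTop
              (nhds ((0:ℝ) • ins 0 y)) := by
            refine Tendsto.smul ?_ ((hcont.tendsto 0).comp (hz.mono_right nhdsWithin_le_nhds))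
            exact (tendsto_atTop_add_const_right _ _ tendsto_natCast_atTop_atTop).inv_tendsto_atTop
          rw [zero_smul] at this
          have h3 := (hbc.tendsto 0).comp this
          rwa [(bmp (d+2)).one_of_mem_closedBall (by simp [(bmp (d+2)).rIn_pos.le])] at h3
        simpa using h1.mul h2

/-- Divergence theorem on the half space. -/
lemma div_lemma {d : ℕ} (F : Fin (d + 2) → (Fin (d + 2) → ℝ) → ℝ) (D B : (Fin (d + 2) → ℝ) → ℝ)
    (F0 b : (Fin (d + 1) → ℝ) → ℝ)
    (hF : ∀ i, ContDiffOn ℝ 1 (F i) (hsp d))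
    (hD : ∀ x ∈ hsp d, ∑ i, pd i (F i) x = D x)
    (hDi : IntegrableOn D (hsp d)) (hB : Integrable B)
    (hFB : ∀ i, ∀ᵐ x, x ∈ hsp d → |F i x| ≤ B x)
    (hb : Integrable b) (hfb : ∀ᵐ y, ∀ t > 0, |F (Fin.last (d+1)) (ins t y)| ≤ b y)
    (hlim : ∀ᵐ y, Tendsto (fun t => F (Fin.last (d+1)) (ins t y))
      (nhdsWithin 0 (Set.Ioi 0)) (nhds (F0 y))) :
    ∫ x in hsp d, D x = - ∫ y, F0 y := by
  have hHm : MeasurableSet (hsp d) := (isOpen_hsp d).measurableSet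
  have hFm : ∀ i, AEStronglyMeasurable (F i) (volume.restrict (hsp d)) := fun i =>
    (hF i).continuousOn.aestronglyMeasurable hHm
  have hFi : ∀ i, IntegrableOn (F i) (hsp d) := fun i =>
    hB.integrableOn.mono' (hFm i) ((ae_restrict_iff' hHm).2 (hFB i))
  obtain ⟨C, hC0, hC⟩ := bmp_pd_bound (d+2)
  have hbd : ContDiff ℝ 1 (bmp (d+2)) := (bmp (d+2)).contDiff
  set N := Fin.last (d+1) with hN
  set T1 : ℕ → ℝ := fun m => ∫ x in hsp d, cutf d ((m:ℝ)+1) x * D x with hT1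
  set T2 : ℕ → ℝ := fun m => ∫ x in hsp d, F N x * (((m:ℝ) + 1) *
      deriv tcut (((m:ℝ) + 1) * x N) * bmp (d+2) (((m:ℝ) + 1)⁻¹ • x)) with hT2
  set T3 : ℕ → ℝ := fun m => ∫ x in hsp d, ∑ i, F i x * (tcut (((m:ℝ)+1) * x N) *
    (((m:ℝ)+1)⁻¹ * pd i (bmp (d + 2)) (((m:ℝ)+1)⁻¹ • x))) with hT3
  have hI1 : ∀ m : ℕ, IntegrableOn (fun x => cutf d ((m:ℝ)+1) x * D x) (hsp d) := fun m =>
    Integrable.bdd_mul (c := 1) hDi (cutf_contDiff d _).continuous.aestronglyMeasurable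
      (ae_of_all _ fun x => cutf_abs_le)
  have hI3 : ∀ m : ℕ, ∀ i, IntegrableOn (fun x => F i x * (tcut (((m:ℝ)+1) * x N) *
    (((m:ℝ)+1)⁻¹ * pd i (bmp (d + 2)) (((m:ℝ)+1)⁻¹ • x)))) (hsp d) := by
    intro m i
    refine Integrable.mul_bdd (c := C) (hFi i) ?_ (ae_of_all _ fun x => ?_)
    · apply Continuous.aestronglyMeasurable
      refine (tcut_contDiff.continuous.comp (continuous_const.mul (continuous_apply _))).mul
        (continuous_const.mul ?_)
      exact Continuous.comp (g := fun x => pd i (bmp (d+2)) x)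
        ((hbd.continuous_fderiv one_ne_zero).clm_apply continuous_const) (continuous_const_smul _)
    · rw [norm_mul, norm_mul, Real.norm_of_nonneg (tcut_nonneg _),
        Real.norm_of_nonneg (by positivity : (0:ℝ) ≤ ((m:ℝ)+1)⁻¹)]
      have h1 : ((m:ℝ)+1)⁻¹ ≤ 1 := inv_le_one_of_one_le₀ (by linarith [Nat.cast_nonneg (α := ℝ) m])
      calc _ ≤ 1 * (1 * C) := by
            gcongr
            · exact tcut_le_one _
            · exact hC _ _
        _ = C := by ring
  obtain ⟨K, hK⟩ : ∃ K, ∀ s, ‖deriv tcut s‖ ≤ K :=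
    tcut_deriv_cont.bounded_above_of_compact_support tcut_deriv_supp
  have hI2 : ∀ m : ℕ, IntegrableOn (fun x => F N x * (((m:ℝ) + 1) *
      deriv tcut (((m:ℝ) + 1) * x N) * bmp (d+2) (((m:ℝ) + 1)⁻¹ • x))) (hsp d) := by
    intro m
    refine Integrable.mul_bdd (c := ((m:ℝ)+1) * K) (hFi N) ?_ (ae_of_all _ fun x => ?_)
    · apply Continuous.aestronglyMeasurable
      exact (continuous_const.mul (tcut_deriv_cont.comp
        (continuous_const.mul (continuous_apply _)))).mul
          (hbd.continuous.comp (continuous_const_smul _))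
    · rw [norm_mul, norm_mul, Real.norm_of_nonneg (by positivity : (0:ℝ) ≤ (m:ℝ)+1)]
      have h1 : ‖bmp (d+2) (((m:ℝ) + 1)⁻¹ • x)‖ ≤ 1 := by
        rw [Real.norm_of_nonneg (bmp _).nonneg]; exact (bmp _).le_one
      have hK0 : 0 ≤ K := (norm_nonneg _).trans (hK 0)
      calc _ ≤ ((m:ℝ)+1) * K * 1 := by
            gcongr
            exact hK _
        _ = _ := by ring
  have hsum : ∀ m, T1 m + T2 m + T3 m = 0 := by
    intro m
    rw [← div_cut F D hF hD ((m:ℝ)+1) (by positivity)]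
    simp only [hT1, hT2, hT3]
    have h12 : IntegrableOn (fun x => cutf d ((m:ℝ)+1) x * D x + F N x * (((m:ℝ) + 1) *
      deriv tcut (((m:ℝ) + 1) * x N) * bmp (d+2) (((m:ℝ) + 1)⁻¹ • x))) (hsp d) :=
      (hI1 m).add (hI2 m)
    rw [← integral_add (hI1 m) (hI2 m), ← integral_add h12
      (integrable_finsetSum _ fun i _ => hI3 m i)]
    congr 1; ext x
    rw [add_assoc]
    congr 1
    simp_rw [cutf_pd, mul_add, Finset.sum_add_distrib]
    congr 1
    rw [Finset.sum_eq_single N]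
    · simp [hN]
    · intro i _ hi
      rw [if_neg hi]; ring
    · simp
  have l1 : Tendsto T1 atTop (nhds (∫ x in hsp d, D x)) := by
    refine tendsto_integral_of_dominated_convergence (fun x => ‖D x‖)
      (fun m => (hI1 m).aestronglyMeasurable) hDi.norm ?_ ?_
    · intro m
      refine ae_of_all _ fun x => ?_
      rw [norm_mul]
      exact mul_le_of_le_one_left (norm_nonneg _) cutf_abs_le
    · refine (ae_restrict_iff' hHm).2 (ae_of_all _ fun x hx => ?_)
      refine tendsto_const_nhds.congr' ?_
      filter_upwards [cutf_eventually_one hx] with m hm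
      rw [hm, one_mul]
  have l2 : Tendsto T2 atTop (nhds (∫ y, F0 y)) := by
    have hmf : Measurable ((hsp d).indicator (F N)) := by
      classical
      have := (hF N).continuousOn.measurable_piecewise (g := fun _ => (0:ℝ)) continuousOn_const hHm
      exact this
    have := layer_limit ((hsp d).indicator (F N)) F0 b hmf
      ((integrable_indicator_iff hHm).2 (hFi N)) hb ?_ ?_
    · refine this.congr fun m => ?_
      simp only [hT2]
      rw [← integral_indicator hHm]
      congr 1; ext x
      by_cases hx : x ∈ hsp d
      · rw [Set.indicator_of_mem hx, Set.indicator_of_mem hx]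
      · rw [Set.indicator_of_notMem hx, Set.indicator_of_notMem hx, zero_mul]
    · filter_upwards [hfb] with y hy t ht
      rw [Set.indicator_of_mem (show ins t y ∈ hsp d by simpa [hsp, ins_last] using ht)]
      exact hy t ht
    · filter_upwards [hlim] with y hy
      refine hy.congr' ?_
      filter_upwards [self_mem_nhdsWithin] with t ht
      rw [Set.indicator_of_mem (show ins t y ∈ hsp d by simpa [hsp, ins_last] using ht)]
  have l3 : Tendsto T3 atTop (nhds 0) := by
    have hb1 : ∀ m : ℕ, ‖T3 m‖ ≤ ((m:ℝ)+1)⁻¹ * ∫ x in hsp d, ∑ i : Fin (d+2), |F i x| * C := by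
      intro m
      rw [← integral_const_mul]
      refine norm_integral_le_of_norm_le ?_ (ae_of_all _ fun x => ?_)
      · exact (integrable_finsetSum _ fun i _ => (hFi i).norm.mul_const _).const_mul _
      · refine (norm_sum_le _ _).trans ?_
        rw [Finset.mul_sum]
        refine Finset.sum_le_sum fun i _ => ?_
        rw [norm_mul, norm_mul, norm_mul, Real.norm_of_nonneg (tcut_nonneg _),
          Real.norm_of_nonneg (by positivity : (0:ℝ) ≤ ((m:ℝ)+1)⁻¹)]
        calc _ ≤ ‖F i x‖ * (1 * (((m:ℝ)+1)⁻¹ * C)) := by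
              gcongr
              · exact tcut_le_one _
              · exact hC _ _
          _ = _ := by rw [Real.norm_eq_abs]; ring
    refine squeeze_zero_norm hb1 ?_
    have : Tendsto (fun m : ℕ => ((m:ℝ)+1)⁻¹) atTop (nhds 0) :=
      (tendsto_atTop_add_const_right _ _ tendsto_natCast_atTop_atTop).inv_tendsto_atTop
    simpa using this.mul_const (∫ x in hsp d, ∑ i : Fin (d+2), |F i x| * C)
  have hl := (l1.add l2).add l3
  have : (fun m => T1 m + T2 m + T3 m) = fun _ => 0 := funext hsum
  rw [this] at hl
  have := tendsto_nhds_unique hl tendsto_const_nhds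
  linarith

/-- squared Euclidean norm -/
def qs {n : ℕ} (x : Fin n → ℝ) : ℝ := ∑ i, x i ^ 2

/-- linear form -/
def lf {n : ℕ} (ξ x : Fin n → ℝ) : ℝ := ∑ i, ξ i * x i

/-- Gaussian weight -/
noncomputable def gw {n : ℕ} (x : Fin n → ℝ) : ℝ := Real.exp (-(qs x) / 2)

lemma norm_sq_le_qs {n : ℕ} (x : Fin n → ℝ) : ‖x‖ ^ 2 ≤ qs x := by
  have h0 : 0 ≤ qs x := Finset.sum_nonneg fun i _ => sq_nonneg _
  have : ‖x‖ ≤ Real.sqrt (qs x) := by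
    rw [pi_norm_le_iff_of_nonneg (Real.sqrt_nonneg _)]
    intro i
    rw [Real.norm_eq_abs]
    apply Real.abs_le_sqrt
    exact Finset.single_le_sum (f := fun i => x i ^ 2) (fun i _ => sq_nonneg _) (Finset.mem_univ i)
  calc ‖x‖ ^ 2 ≤ (Real.sqrt (qs x)) ^ 2 := by gcongr
    _ = qs x := Real.sq_sqrt h0

lemma poly_exp_bound (M : ℕ) (K : ℝ) (hK : 0 ≤ K) : ∃ C : ℝ, 0 ≤ C ∧ ∀ s : ℝ, 0 ≤ s →
    (1 + s) ^ M * Real.exp (K * s) ≤ C * Real.exp (s ^ 2 / 4) := by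
  refine ⟨M.factorial * Real.exp (1 + (K+1)^2), by positivity, fun s hs => ?_⟩
  have h1 := Real.pow_div_factorial_le_exp (1 + s) (by linarith) M
  rw [div_le_iff₀ (by positivity)] at h1
  calc (1 + s) ^ M * Real.exp (K * s) ≤ (Real.exp (1 + s) * M.factorial) * Real.exp (K * s) := by
        gcongr
    _ = M.factorial * Real.exp (1 + s + K * s) := by rw [Real.exp_add (1 + s)]; ring
    _ ≤ M.factorial * Real.exp (1 + (K+1)^2 + s^2/4) := by
        refine mul_le_mul_of_nonneg_left (Real.exp_le_exp.2 ?_) (by positivity)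
        nlinarith [sq_nonneg ((K+1) - s/2)]
    _ = _ := by rw [Real.exp_add (1 + (K+1)^2)]; ring

lemma poly_gw_bound (n M : ℕ) (K : ℝ) (hK : 0 ≤ K) : ∃ C : ℝ, 0 ≤ C ∧ ∀ x : Fin n → ℝ,
    (1 + ‖x‖) ^ M * Real.exp (K * ‖x‖) * gw x ≤ C * Real.exp (-(qs x) / 4) := by
  obtain ⟨C, hC0, hC⟩ := poly_exp_bound M K hK
  refine ⟨C, hC0, fun x => ?_⟩
  have h1 := hC ‖x‖ (norm_nonneg _)
  have h2 := norm_sq_le_qs x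
  calc _ ≤ C * Real.exp (‖x‖ ^ 2 / 4) * gw x := by
        gcongr
        exact (Real.exp_pos _).le
    _ ≤ C * Real.exp (qs x / 4) * gw x := by
        gcongr
        exact (Real.exp_pos _).le
    _ = _ := by
        rw [gw, mul_assoc, ← Real.exp_add]; congr 2; ring

/-- dominating function -/
noncomputable def bf {n : ℕ} (α : ℝ) (x : Fin (n+1) → ℝ) : ℝ :=
  |x 0| ^ α * Real.exp (-(qs x) / 4)

lemma integrable_abs_rpow (α : ℝ) (hα : -1 < α) :
    Integrable (fun s : ℝ => |s| ^ α * Real.exp (-(s^2)/4)) := by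
  have h := integrableOn_rpow_mul_exp_neg_mul_sq (b := 1/4) (by norm_num) hα
  have h1 : IntegrableOn (fun s : ℝ => |s| ^ α * Real.exp (-(s^2)/4)) (Set.Ioi 0) := by
    refine h.congr_fun (fun x hx => ?_) measurableSet_Ioi
    simp only
    rw [abs_of_pos hx]
    congr 2; ring
  rw [← integrableOn_univ, ← @Iio_union_Ici _ _ (0 : ℝ), integrableOn_union,
    integrableOn_Ici_iff_integrableOn_Ioi]
  refine ⟨?_, h1⟩
  rw [← (Measure.measurePreserving_neg (volume : Measure ℝ)).integrableOn_comp_preimage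
      (Homeomorph.neg ℝ).measurableEmbedding]
  simpa only [Function.comp_def, neg_sq, Set.neg_preimage, Set.neg_Iio, neg_zero, abs_neg] using h1

lemma integrable_bf {n : ℕ} (α : ℝ) (hα : -1 < α) : Integrable (bf (n := n) α) := by
  have hg : Integrable (fun s : ℝ => Real.exp (-(s^2)/4)) := by
    have := integrable_abs_rpow 0 (by norm_num)
    simpa using this
  have h := Integrable.fintype_prod (ι := Fin (n+1)) (𝕜 := ℝ) (E := ℝ)
    (f := fun i s => if i = 0 then |s| ^ α * Real.exp (-(s^2)/4) else Real.exp (-(s^2)/4))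
    (μ := fun _ => volume) (fun i => by
      by_cases hi : i = 0
      · simpa [hi] using integrable_abs_rpow α hα
      · simpa [hi] using hg)
  refine h.congr (ae_of_all _ fun x => ?_)
  simp only [bf, qs]
  rw [← Finset.sum_neg_distrib, Finset.sum_div, Real.exp_sum, Fin.prod_univ_succ,
    Fin.prod_univ_succ]
  simp [mul_assoc]

lemma integrable_exp_qs {n : ℕ} :
    Integrable (fun x : Fin (n+1) → ℝ => Real.exp (-(qs x) / 4)) := by
  have := integrable_bf (n := n) 0 (by norm_num)
  refine this.congr (ae_of_all _ fun x => ?_)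
  simp [bf]

lemma qs_cont {n : ℕ} : Continuous (qs (n := n)) :=
  continuous_finsetSum _ fun i _ => (continuous_apply i).pow 2
lemma lf_cont {n : ℕ} (ξ : Fin n → ℝ) : Continuous (lf ξ) :=
  continuous_finsetSum _ fun i _ => continuous_const.mul (continuous_apply i)
lemma gw_cont {n : ℕ} : Continuous (gw (n := n)) :=
  Real.continuous_exp.comp (qs_cont.neg.div_const _)
lemma gw_pos {n : ℕ} (x : Fin n → ℝ) : 0 < gw x := Real.exp_pos _

lemma lf_abs_le {n : ℕ} (ξ x : Fin n → ℝ) : |lf ξ x| ≤ (∑ i, |ξ i|) * ‖x‖ := by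
  rw [lf, Finset.sum_mul]
  refine (Finset.abs_sum_le_sum_abs _ _).trans (Finset.sum_le_sum fun i _ => ?_)
  rw [abs_mul]
  gcongr
  exact norm_le_pi_norm x i

/- derivatives -/
lemma pd_mul' {n : ℕ} {f g : (Fin n → ℝ) → ℝ} {x : Fin n → ℝ} (i : Fin n)
    (hf : DifferentiableAt ℝ f x) (hg : DifferentiableAt ℝ g x) :
    pd i (fun x => f x * g x) x = f x * pd i g x + g x * pd i f x := by
  have h4 : pd i (fun x => f x * g x) x = _ :=
    congrArg (fun L => L (Pi.single i 1)) (hf.hasFDerivAt.mul hg.hasFDerivAt).fderiv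
  rw [h4]; simp [pd]

lemma pd_sub' {n : ℕ} {f g : (Fin n → ℝ) → ℝ} {x : Fin n → ℝ} (i : Fin n)
    (hf : DifferentiableAt ℝ f x) (hg : DifferentiableAt ℝ g x) :
    pd i (fun x => f x - g x) x = pd i f x - pd i g x := by
  have h4 : pd i (fun x => f x - g x) x = _ :=
    congrArg (fun L => L (Pi.single i 1)) (hf.hasFDerivAt.sub hg.hasFDerivAt).fderiv
  rw [h4]; simp [pd]

lemma qs_contDiff {n : ℕ} : ContDiff ℝ 2 (qs (n := n)) :=
  ContDiff.sum fun i _ => (contDiff_apply ℝ ℝ i).pow 2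
lemma lf_contDiff {n : ℕ} (ξ : Fin n → ℝ) : ContDiff ℝ 2 (lf ξ) :=
  ContDiff.sum fun i _ => contDiff_const.mul (contDiff_apply ℝ ℝ i)
lemma gw_contDiff {n : ℕ} : ContDiff ℝ 2 (gw (n := n)) :=
  (qs_contDiff.neg.div_const _).exp

lemma hasFDerivAt_lf {n : ℕ} (ξ x : Fin n → ℝ) : HasFDerivAt (lf ξ)
    (∑ i, ξ i • (ContinuousLinearMap.proj i : (Fin n → ℝ) →L[ℝ] ℝ)) x := by
  have h : ∀ i ∈ Finset.univ, HasFDerivAt (fun x : Fin n → ℝ => ξ i * x i)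
    (ξ i • (ContinuousLinearMap.proj i : (Fin n → ℝ) →L[ℝ] ℝ)) x := fun i _ =>
      (hasFDerivAt_apply (𝕜 := ℝ) i x).const_mul (ξ i)
  exact HasFDerivAt.fun_sum h

lemma pd_lf_pow {n : ℕ} (ξ x : Fin n → ℝ) (k : ℕ) (i : Fin n) :
    pd i (fun x => lf ξ x ^ k) x = k * lf ξ x ^ (k-1) * ξ i := by
  have h := ((hasFDerivAt_lf ξ x).pow k).fderiv
  have h4 : pd i (fun x => lf ξ x ^ k) x = _ := congrArg (fun L => L (Pi.single i 1)) h
  rw [h4]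
  simp [Pi.single_apply]

lemma pd_gw {n : ℕ} (x : Fin n → ℝ) (i : Fin n) : pd i gw x = - x i * gw x := by
  have h : ∀ i ∈ Finset.univ, HasFDerivAt (fun x : Fin n → ℝ => x i ^ 2)
    ((2 * x i) • (ContinuousLinearMap.proj i : (Fin n → ℝ) →L[ℝ] ℝ)) x := fun i _ => by
      simpa using (hasFDerivAt_apply (𝕜 := ℝ) i x).pow 2
  have h1 : HasFDerivAt (qs (n := n)) _ x := HasFDerivAt.fun_sum h
  have h2 := (h1.neg.mul_const (2⁻¹ : ℝ)).exp.fderiv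
  have e : gw = fun x : Fin n → ℝ => Real.exp ((-qs x) * 2⁻¹) := by
    ext x; rw [gw, div_eq_mul_inv]
  rw [pd]
  nth_rewrite 1 [e]
  erw [h2]
  simp [Pi.single_apply, gw, div_eq_mul_inv]
  ring

lemma hsp_sub {d : ℕ} (u : (Fin (d + 2) → ℝ) → ℝ) :
    hsp d ⊆ (contactSet u (Fin.last (d+1)))ᶜ := by
  intro x hx h
  have : 0 < x (Fin.last (d+1)) := hx
  exact this.ne' h.1

lemma u_contDiffOn {d : ℕ} {μ : ℝ} {u : (Fin (d + 2) → ℝ) → ℝ}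
    (hu : IsTOPSol μ u (Fin.last (d + 1))) : ContDiffOn ℝ 2 u (hsp d) :=
  hu.smooth.mono (hsp_sub u)

lemma u_diffAt {d : ℕ} {μ : ℝ} {u : (Fin (d + 2) → ℝ) → ℝ}
    (hu : IsTOPSol μ u (Fin.last (d + 1))) {x : Fin (d+2) → ℝ} (hx : x ∈ hsp d) :
    DifferentiableAt ℝ u x :=
  ((u_contDiffOn hu).contDiffAt ((isOpen_hsp d).mem_nhds hx)).differentiableAt two_ne_zero

lemma pd_contDiffOn {d : ℕ} {μ : ℝ} {u : (Fin (d + 2) → ℝ) → ℝ}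
    (hu : IsTOPSol μ u (Fin.last (d + 1))) (i : Fin (d+2)) :
    ContDiffOn ℝ 1 (pd i u) (hsp d) := by
  have h := (u_contDiffOn hu).fderiv_of_isOpen (m := 1) (isOpen_hsp d) (by norm_num)
  exact h.clm_apply contDiffOn_const

lemma u_zero {d : ℕ} {μ : ℝ} (hμ : 0 < μ) {u : (Fin (d + 2) → ℝ) → ℝ}
    (hu : IsTOPSol μ u (Fin.last (d + 1))) : u 0 = 0 := by
  have h := hu.homog 2 two_pos 0
  rw [smul_zero] at h
  have h2 : (1:ℝ) < 2 ^ μ := Real.one_lt_rpow one_lt_two hμ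
  by_contra h0
  have : (2:ℝ) ^ μ = 1 := by
    have : ((2:ℝ) ^ μ - 1) * u 0 = 0 := by linarith
    rcases mul_eq_zero.1 this with h' | h'
    · linarith
    · exact absurd h' h0
  linarith

lemma u_bound {d : ℕ} {μ : ℝ} (hμ : 0 < μ) {u : (Fin (d + 2) → ℝ) → ℝ}
    (hu : IsTOPSol μ u (Fin.last (d + 1))) : ∃ C, 0 ≤ C ∧ ∀ x, |u x| ≤ C * ‖x‖ ^ μ := by
  obtain ⟨C, hC⟩ := (isCompact_sphere (0 : Fin (d+2) → ℝ) 1).exists_bound_of_continuousOn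
    hu.cont.continuousOn
  refine ⟨|C|, abs_nonneg _, fun x => ?_⟩
  by_cases hx : x = 0
  · subst hx
    rw [u_zero hμ hu]; simp [Real.zero_rpow hμ.ne']
  · have hn : 0 < ‖x‖ := norm_pos_iff.2 hx
    have e : u x = ‖x‖ ^ μ * u (‖x‖⁻¹ • x) := by
      rw [← hu.homog _ hn, smul_smul, mul_inv_cancel₀ hn.ne', one_smul]
    have h1 := hC (‖x‖⁻¹ • x) (by simp [norm_smul, hn.ne'])
    rw [e, abs_mul, abs_of_nonneg (by positivity), mul_comm]
    exact mul_le_mul_of_nonneg_right (h1.trans (le_abs_self _)) (by positivity)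

lemma pd_homog {d : ℕ} {μ : ℝ} {u : (Fin (d + 2) → ℝ) → ℝ}
    (hu : IsTOPSol μ u (Fin.last (d + 1))) {x : Fin (d+2) → ℝ} (hx : x ∈ hsp d) (i : Fin (d+2))
    (r : ℝ) (hr : 0 < r) : pd i u (r • x) = r ^ (μ - 1) * pd i u x := by
  have hx' : 0 < x (Fin.last (d+1)) := hx
  have hrx : r • x ∈ hsp d := by
    show 0 < (r • x) (Fin.last (d+1))
    simp only [Pi.smul_apply, smul_eq_mul]; positivity
  have h1 : HasFDerivAt (fun y => u (r • y)) ((fderiv ℝ u (r • x)).comp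
      (r • ContinuousLinearMap.id ℝ _)) x :=
    HasFDerivAt.comp (g := u) (f := fun x => r • x) x (u_diffAt hu hrx).hasFDerivAt
      ((hasFDerivAt_id x).const_smul r)
  have h2 : HasFDerivAt (fun y => u (r • y)) (r ^ μ • fderiv ℝ u x) x := by
    have : (fun y => u (r • y)) = fun y => r ^ μ * u y := funext fun y => hu.homog r hr y
    rw [this]
    exact (u_diffAt hu hx).hasFDerivAt.const_mul _
  have h3 := congrArg (fun L => L (Pi.single i 1)) (h1.unique h2)
  simp only [ContinuousLinearMap.comp_apply, smul_apply, ContinuousLinearMap.id_apply, map_smul,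
    smul_eq_mul] at h3
  rw [Real.rpow_sub hr, Real.rpow_one]
  simp only [pd]
  field_simp
  linarith

lemma euler {d : ℕ} {μ : ℝ} {u : (Fin (d + 2) → ℝ) → ℝ}
    (hu : IsTOPSol μ u (Fin.last (d + 1))) {x : Fin (d+2) → ℝ} (hx : x ∈ hsp d) :
    ∑ i, x i * pd i u x = μ * u x := by
  have h1 : HasDerivAt (fun r : ℝ => u (r • x)) (fderiv ℝ u x x) 1 := by
    have hd : HasFDerivAt u (fderiv ℝ u x) ((1:ℝ) • x) := by
      rw [one_smul]; exact (u_diffAt hu hx).hasFDerivAt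
    have := hd.comp_hasDerivAt (1:ℝ) ((hasDerivAt_id (1:ℝ)).smul_const x)
    rw [one_smul] at this
    exact this
  have h2 : HasDerivAt (fun r : ℝ => u (r • x)) (μ * u x) 1 := by
    have h3 : HasDerivAt (fun r : ℝ => r ^ μ * u x) (μ * u x) 1 := by
      have := (Real.hasDerivAt_rpow_const (x := 1) (p := μ) (Or.inl one_ne_zero)).mul_const (u x)
      simpa using this
    refine h3.congr_of_eventuallyEq ?_
    filter_upwards [Ioi_mem_nhds (zero_lt_one (α := ℝ))] with r hr using hu.homog r hr x
  rw [← h1.unique h2]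
  conv_rhs => rw [show x = ∑ i, x i • (Pi.single i (1:ℝ) : Fin (d+2) → ℝ) by
    ext j; simp [Finset.sum_apply, Pi.single_apply]]
  simp only [map_sum, map_smul, smul_eq_mul]
  have e : (∑ i, x i • (Pi.single i (1:ℝ) : Fin (d+2) → ℝ)) = x := by
    ext j; simp [Finset.sum_apply, Pi.single_apply]
  rw [e]
  rfl

lemma pd_bound {d : ℕ} {μ : ℝ} {u : (Fin (d + 2) → ℝ) → ℝ}
    (hu : IsTOPSol μ u (Fin.last (d + 1)))
    (G : (Fin (d + 2) → ℝ) → Fin (d + 2) → ℝ)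
    (hGcont : ContinuousOn G ({x : Fin (d + 2) → ℝ | 0 ≤ x (Fin.last (d + 1))} \ {0}))
    (hGgrad : ∀ x : Fin (d + 2) → ℝ, 0 < x (Fin.last (d + 1)) →
      ∀ i : Fin (d + 2), G x i = pd i u x) :
    ∃ C, 0 ≤ C ∧ ∀ x ∈ hsp d, ∀ i, |pd i u x| ≤ C * ‖x‖ ^ (μ - 1) := by
  have hcomp : IsCompact (Metric.sphere (0 : Fin (d+2) → ℝ) 1 ∩
      {x : Fin (d + 2) → ℝ | 0 ≤ x (Fin.last (d + 1))}) :=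
    (isCompact_sphere _ _).inter_right (isClosed_le continuous_const (continuous_apply _))
  obtain ⟨C, hC⟩ := hcomp.exists_bound_of_continuousOn (hGcont.mono (by
    rintro x ⟨h1, h2⟩
    refine ⟨h2, ?_⟩
    rintro rfl
    simp at h1))
  refine ⟨|C|, abs_nonneg _, fun x hx i => ?_⟩
  have hx' : 0 < x (Fin.last (d+1)) := hx
  have hn : 0 < ‖x‖ := norm_pos_iff.2 (by rintro rfl; simp at hx')
  have hy : ‖x‖⁻¹ • x ∈ hsp d := by
    show 0 < (‖x‖⁻¹ • x) (Fin.last (d+1))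
    simp only [Pi.smul_apply, smul_eq_mul]; positivity
  have e : pd i u x = ‖x‖ ^ (μ-1) * pd i u (‖x‖⁻¹ • x) := by
    rw [← pd_homog hu hy i _ hn, smul_smul, mul_inv_cancel₀ hn.ne', one_smul]
  have h1 := hC (‖x‖⁻¹ • x) ⟨by simp [norm_smul, hn.ne'],
    show 0 ≤ (‖x‖⁻¹ • x) (Fin.last (d+1)) from le_of_lt hy⟩
  rw [e, ← hGgrad _ hy, abs_mul, abs_of_nonneg (by positivity), mul_comm]
  exact mul_le_mul_of_nonneg_right
    ((norm_le_pi_norm _ i).trans (h1.trans (le_abs_self _))) (by positivity)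

lemma ins_add {d : ℕ} (t : ℝ) (y : Fin (d + 1) → ℝ) :
    ins 0 y + t • (Pi.single (Fin.last (d+1)) 1 : Fin (d+2) → ℝ) = ins t y := by
  ext i
  refine Fin.lastCases ?_ (fun i => ?_) i
  · simp [ins_last]
  · simp [ins_castSucc, Pi.single_apply, Fin.castSucc_ne_last]

lemma ins_zero_ne {d : ℕ} {y : Fin (d + 1) → ℝ} (hy : y ≠ 0) (t : ℝ) : ins t y ≠ 0 := by
  intro h
  apply hy
  ext i
  rw [← ins_castSucc t y i, h]; rfl

lemma G_tendsto {d : ℕ} 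
    (G : (Fin (d + 2) → ℝ) → Fin (d + 2) → ℝ)
    (hGcont : ContinuousOn G ({x : Fin (d + 2) → ℝ | 0 ≤ x (Fin.last (d + 1))} \ {0}))
    {y : Fin (d + 1) → ℝ} (hy : y ≠ 0) (i : Fin (d+2)) :
    Tendsto (fun t => G (ins t y) i) (nhdsWithin 0 (Set.Ioi 0)) (nhds (G (ins 0 y) i)) := by
  have h1 := hGcont (ins 0 y) ⟨by simp [ins_last], ins_zero_ne hy 0⟩
  have h2 : Tendsto (fun t => ins t y) (nhdsWithin 0 (Set.Ioi 0))
      (nhdsWithin (ins 0 y) ({x : Fin (d + 2) → ℝ | 0 ≤ x (Fin.last (d + 1))} \ {0})) := by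
    rw [tendsto_nhdsWithin_iff]
    constructor
    · exact ((ins_cont.comp (continuous_id.prodMk continuous_const)).tendsto (0:ℝ)).mono_left
        nhdsWithin_le_nhds
    · filter_upwards [self_mem_nhdsWithin] with t ht
      exact ⟨by simpa [ins_last] using le_of_lt ht, ins_zero_ne hy t⟩
  exact ((continuous_apply i).tendsto _).comp (h1.tendsto.comp h2)

lemma G_nonpos {d : ℕ} {μ : ℝ} {u : (Fin (d + 2) → ℝ) → ℝ}
    (hu : IsTOPSol μ u (Fin.last (d + 1)))
    (G : (Fin (d + 2) → ℝ) → Fin (d + 2) → ℝ)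
    (hGcont : ContinuousOn G ({x : Fin (d + 2) → ℝ | 0 ≤ x (Fin.last (d + 1))} \ {0}))
    (hGgrad : ∀ x : Fin (d + 2) → ℝ, 0 < x (Fin.last (d + 1)) →
      ∀ i : Fin (d + 2), G x i = pd i u x) {y : Fin (d + 1) → ℝ} (hy : y ≠ 0) :
    G (ins 0 y) (Fin.last (d+1)) ≤ 0 := by
  obtain ⟨e, he, h⟩ := hu.upper (ins 0 y) (ins_last 0 y)
  have hder : ∀ t : ℝ, 0 < t → HasDerivAt (fun t => u (ins t y)) (G (ins t y) (Fin.last (d+1))) t := by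
    intro t ht
    have hx : ins t y ∈ hsp d := by simpa [hsp, ins_last] using ht
    rw [hGgrad _ hx, pd]
    have hl : HasDerivAt (fun t => ins t y) (Pi.single (Fin.last (d+1)) 1 : Fin (d+2) → ℝ) t := by
      have : (fun t => ins t y) = fun t => ins 0 y +
        t • (Pi.single (Fin.last (d+1)) 1 : Fin (d+2) → ℝ) := funext fun t => (ins_add t y).symm
      rw [this]
      have h2 := ((hasDerivAt_id t).smul_const (Pi.single (Fin.last (d+1)) 1 : Fin (d+2) → ℝ)).const_add (ins 0 y)
      simpa using h2
    exact (u_diffAt hu hx).hasFDerivAt.comp_hasDerivAt t hl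
  have hlim : HasDerivWithinAt (fun t => u (ins t y)) (G (ins 0 y) (Fin.last (d+1))) (Set.Ici 0) 0 := by
    refine hasDerivWithinAt_Ici_of_tendsto_deriv (s := Set.Ioi 0)
      (fun t ht => (hder t ht).differentiableAt.differentiableWithinAt) ?_ self_mem_nhdsWithin ?_
    · exact (hu.cont.comp (ins_cont.comp (continuous_id.prodMk continuous_const))).continuousWithinAt
    · refine (G_tendsto G hGcont hy (Fin.last (d+1))).congr' ?_
      filter_upwards [self_mem_nhdsWithin] with t ht
      exact (hder t ht).deriv.symm
  have h2 := (hasDerivWithinAt_iff_tendsto_slope' (by simp)).1 (hlim.mono Set.Ioi_subset_Ici_self)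
  have h3 : Tendsto (fun t : ℝ => (u (ins 0 y + t • (Pi.single (Fin.last (d+1)) 1 : Fin (d+2) → ℝ)) - u (ins 0 y)) / t)
    (nhdsWithin 0 (Set.Ioi 0)) (nhds (G (ins 0 y) (Fin.last (d+1)))) := by
    refine h2.congr fun t => ?_
    rw [slope_def_field, ins_add, sub_zero]
  have := tendsto_nhds_unique h h3
  linarith

/-- a priori bound for the flux -/
lemma rpow_dom {s a μ : ℝ} (ha : 0 < a) (has : a ≤ s) (M : ℕ) (hM : μ ≤ M) :
    s ^ (μ - 1) ≤ a ^ (min (μ - 1) 0) * (1 + s) ^ M := by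
  have hs : 0 < s := lt_of_lt_of_le ha has
  have h1 : (1:ℝ) ≤ (1 + s) ^ M := one_le_pow₀ (by linarith)
  rcases le_total (μ - 1) 0 with h | h
  · rw [min_eq_left h]
    calc s ^ (μ - 1) ≤ a ^ (μ - 1) := Real.rpow_le_rpow_of_nonpos ha has h
      _ ≤ _ := le_mul_of_one_le_right (by positivity) h1
  · rw [min_eq_right h, Real.rpow_zero, one_mul, ← Real.rpow_natCast]
    calc s ^ (μ - 1) ≤ (1 + s) ^ (μ - 1) := Real.rpow_le_rpow hs.le (by linarith) h
      _ ≤ _ := Real.rpow_le_rpow_of_exponent_le (by linarith) (by linarith)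

lemma rpow_dom' {s μ : ℝ} (hs : 0 ≤ s) (hμ : 0 < μ) (M : ℕ) (hM : μ ≤ M) :
    s ^ μ ≤ (1 + s) ^ M := by
  rw [← Real.rpow_natCast]
  calc s ^ μ ≤ (1 + s) ^ μ := Real.rpow_le_rpow hs (by linarith) hμ.le
      _ ≤ _ := Real.rpow_le_rpow_of_exponent_le (by linarith) (by linarith)

lemma u_bound2 {d : ℕ} {μ : ℝ} (hμ : 0 < μ) {u : (Fin (d + 2) → ℝ) → ℝ}
    (hu : IsTOPSol μ u (Fin.last (d + 1))) :
    ∃ C, 0 ≤ C ∧ ∃ M : ℕ, ∀ x, |u x| ≤ C * (1 + ‖x‖) ^ M := by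
  obtain ⟨C, hC0, hC⟩ := u_bound hμ hu
  refine ⟨C, hC0, ⌈μ⌉₊, fun x => (hC x).trans ?_⟩
  exact mul_le_mul_of_nonneg_left (rpow_dom' (norm_nonneg _) hμ _ (Nat.le_ceil _)) hC0

lemma u_exp_integrable {d : ℕ} {μ : ℝ} (hμ : 0 < μ) {u : (Fin (d + 2) → ℝ) → ℝ}
    (hu : IsTOPSol μ u (Fin.last (d + 1))) (K : ℝ) (hK : 0 ≤ K) :
    Integrable (fun x => |u x| * Real.exp (K * ‖x‖) * gw x) := by
  obtain ⟨C, hC0, M, hC⟩ := u_bound2 hμ hu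
  obtain ⟨C', hC0', hC'⟩ := poly_gw_bound (d+2) M K hK
  refine Integrable.mono' ((integrable_exp_qs (n := d+1)).const_mul (C * C')) ?_ ?_
  · exact (((hu.cont.abs).mul (Real.continuous_exp.comp
      (continuous_const.mul continuous_norm))).mul gw_cont).aestronglyMeasurable
  · refine ae_of_all _ fun x => ?_
    rw [Real.norm_eq_abs, abs_of_nonneg (by have := gw_pos x; positivity)]
    calc |u x| * Real.exp (K * ‖x‖) * gw x ≤ C * (1 + ‖x‖) ^ M * Real.exp (K * ‖x‖) * gw x := by
          have := gw_pos x
          have := hC x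
          gcongr
      _ = C * ((1 + ‖x‖) ^ M * Real.exp (K * ‖x‖) * gw x) := by ring
      _ ≤ C * (C' * Real.exp (-(qs x) / 4)) := mul_le_mul_of_nonneg_left (hC' x) hC0
      _ = _ := by ring

lemma lf_pow_le {n : ℕ} (ξ x : Fin n → ℝ) (k : ℕ) :
    |lf ξ x| ^ k ≤ k.factorial * Real.exp ((∑ i, |ξ i|) * ‖x‖) := by
  have h1 : |lf ξ x| ^ k ≤ ((∑ i, |ξ i|) * ‖x‖) ^ k :=
    pow_le_pow_left₀ (abs_nonneg _) (lf_abs_le ξ x) k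
  have h0 : 0 ≤ (∑ i, |ξ i|) * ‖x‖ :=
    mul_nonneg (Finset.sum_nonneg fun i _ => abs_nonneg _) (norm_nonneg _)
  have h2 := Real.pow_div_factorial_le_exp _ h0 k
  rw [div_le_iff₀ (by positivity)] at h2
  linarith

lemma mom_integrable {d : ℕ} {μ : ℝ} (hμ : 0 < μ) {u : (Fin (d + 2) → ℝ) → ℝ}
    (hu : IsTOPSol μ u (Fin.last (d + 1))) (ξ : Fin (d+2) → ℝ) (k : ℕ) :
    Integrable (fun x => u x * lf ξ x ^ k * gw x) := by
  refine Integrable.mono' ((u_exp_integrable hμ hu (∑ i, |ξ i|)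
    (Finset.sum_nonneg fun i _ => abs_nonneg _)).const_mul k.factorial) ?_ ?_
  · exact ((hu.cont.mul ((lf_cont ξ).pow k)).mul gw_cont).aestronglyMeasurable
  · refine ae_of_all _ fun x => ?_
    rw [Real.norm_eq_abs, abs_mul, abs_mul, abs_of_pos (gw_pos x), abs_pow]
    have := mul_le_mul_of_nonneg_left (lf_pow_le ξ x k) (abs_nonneg (u x))
    have := mul_le_mul_of_nonneg_right this (gw_pos x).le
    linarith

/-- moments of `u` over the half space against the Gaussian weight -/
noncomputable def mom {d : ℕ} (u : (Fin (d + 2) → ℝ) → ℝ) (ξ : Fin (d+2) → ℝ) (k : ℕ) : ℝ :=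
  ∫ x in hsp d, u x * lf ξ x ^ k * gw x

/-- the flux vector field -/
noncomputable def flux {d : ℕ} (u : (Fin (d + 2) → ℝ) → ℝ) (ξ : Fin (d+2) → ℝ) (k : ℕ)
    (i : Fin (d+2)) (x : Fin (d+2) → ℝ) : ℝ :=
  gw x * (lf ξ x ^ k * pd i u x - u x * (lf ξ x ^ (k-1) * (k * ξ i)))

lemma flux_contDiffOn {d : ℕ} {μ : ℝ} {u : (Fin (d + 2) → ℝ) → ℝ}
    (hu : IsTOPSol μ u (Fin.last (d + 1))) (ξ : Fin (d+2) → ℝ) (k : ℕ) (i : Fin (d+2)) :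
    ContDiffOn ℝ 1 (flux u ξ k i) (hsp d) := by
  have h12 : (1 : WithTop ℕ∞) ≤ 2 := by norm_num
  have hg : ContDiffOn ℝ 1 (gw (n := d+2)) (hsp d) := (gw_contDiff.of_le h12).contDiffOn
  have hl : ContDiffOn ℝ 1 (lf ξ) (hsp d) := ((lf_contDiff ξ).of_le h12).contDiffOn
  have h1 := pd_contDiffOn hu i
  have h2 := (u_contDiffOn hu).of_le h12
  exact hg.mul (((hl.pow k).mul h1).sub (h2.mul ((hl.pow (k-1)).mul contDiffOn_const)))

lemma flux_div {d : ℕ} {μ : ℝ} {u : (Fin (d + 2) → ℝ) → ℝ}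
    (hu : IsTOPSol μ u (Fin.last (d + 1))) (ξ : Fin (d+2) → ℝ) (k : ℕ)
    (x : Fin (d+2) → ℝ) (hx : x ∈ hsp d) :
    ∑ i, pd i (flux u ξ k i) x = (k - μ) * (u x * lf ξ x ^ k * gw x) -
      (k * (k-1 : ℕ) * qs ξ) * (u x * lf ξ x ^ (k-2) * gw x) := by
  have hnb := (isOpen_hsp d).mem_nhds hx
  have dg : DifferentiableAt ℝ (gw (n := d+2)) x := gw_contDiff.differentiable two_ne_zero x
  have dl : ∀ m, DifferentiableAt ℝ (fun x => lf ξ x ^ m) x := fun m =>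
    ((lf_contDiff ξ).pow m).differentiable two_ne_zero x
  have du := u_diffAt hu hx
  have dp : ∀ i, DifferentiableAt ℝ (pd i u) x := fun i =>
    ((pd_contDiffOn hu i).contDiffAt hnb).differentiableAt one_ne_zero
  have key : ∀ i, pd i (flux u ξ k i) x = gw x * (lf ξ x ^ k * pd i (pd i u) x)
      - gw x * u x * (k * (k-1 : ℕ)) * lf ξ x ^ (k-2) * ξ i ^ 2
      - gw x * lf ξ x ^ k * (x i * pd i u x)
      + gw x * u x * k * lf ξ x ^ (k-1) * (ξ i * x i) := by
    intro i
    have dq : DifferentiableAt ℝ (fun x => lf ξ x ^ (k-1) * (k * ξ i)) x :=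
      (dl (k-1)).mul_const _
    have e1 : pd i (fun x => lf ξ x ^ k * pd i u x) x = _ := pd_mul' i (dl k) (dp i)
    have e2 : pd i (fun x => lf ξ x ^ (k-1) * (k * ξ i)) x = _ :=
      pd_mul' i (dl (k-1)) (differentiableAt_const _)
    have e3 : pd i (fun x => u x * (lf ξ x ^ (k-1) * (k * ξ i))) x = _ := pd_mul' i du dq
    have e4 : pd i (fun x => lf ξ x ^ k * pd i u x - u x * (lf ξ x ^ (k-1) * (k * ξ i))) x = _ :=
      pd_sub' i ((dl k).mul (dp i)) (du.mul dq)
    have e5 : pd i (flux u ξ k i) x = _ :=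
      pd_mul' i dg (((dl k).mul (dp i)).sub (du.mul dq))
    have e6 : pd i (fun _ : Fin (d+2) → ℝ => (k * ξ i : ℝ)) x = 0 := by simp [pd]
    rw [e5, e4, e3, e2, e1, e6, pd_lf_pow, pd_lf_pow, pd_gw, show k - 1 - 1 = k - 2 by omega]
    ring
  have hl : lap u x = 0 := hu.harm x (hsp_sub u hx)
  have he := euler hu hx
  simp only [key, Finset.sum_add_distrib, Finset.sum_sub_distrib, ← Finset.mul_sum]
  rw [he]
  have hl' : ∑ i, pd i (pd i u) x = 0 := hl
  rw [hl']
  have e1 : ∑ i, ξ i ^ 2 = qs ξ := rfl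
  have e2 : ∑ i, ξ i * x i = lf ξ x := rfl
  rw [e1, e2]
  rcases k with _ | k
  · simp; ring
  · simp only [Nat.add_sub_cancel]
    push_cast
    ring

lemma flux_bound {d : ℕ} {μ : ℝ} (hμ : 0 < μ) {u : (Fin (d + 2) → ℝ) → ℝ}
    (hu : IsTOPSol μ u (Fin.last (d + 1)))
    (G : (Fin (d + 2) → ℝ) → Fin (d + 2) → ℝ)
    (hGcont : ContinuousOn G ({x : Fin (d + 2) → ℝ | 0 ≤ x (Fin.last (d + 1))} \ {0}))
    (hGgrad : ∀ x : Fin (d + 2) → ℝ, 0 < x (Fin.last (d + 1)) →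
      ∀ i : Fin (d + 2), G x i = pd i u x) (ξ : Fin (d+2) → ℝ) (k : ℕ) :
    ∃ C, 0 ≤ C ∧ ∀ i, ∀ x ∈ hsp d, x 0 ≠ 0 → |flux u ξ k i x| ≤ C * bf (min (μ - 1) 0) x := by
  obtain ⟨C1, hC10, hC1⟩ := pd_bound hu G hGcont hGgrad
  obtain ⟨C2, hC20, hC2⟩ := u_bound hμ hu
  set M := ⌈μ⌉₊
  set K := ∑ i, |ξ i| with hKdef
  have hK0 : 0 ≤ K := Finset.sum_nonneg fun i _ => abs_nonneg _
  obtain ⟨C3, hC30, hC3⟩ := poly_gw_bound (d+2) (M + k + 1) 0 le_rfl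
  set E := K ^ k * C1 + C2 * (K ^ (k-1) * (k * K)) with hE
  have hE0 : 0 ≤ E := by positivity
  refine ⟨E * C3, by positivity, fun i x hx hx0 => ?_⟩
  set S := ‖x‖ with hS
  have ha : 0 < |x 0| := abs_pos.2 hx0
  have haS : |x 0| ≤ S := norm_le_pi_norm x 0
  have hSp : 0 < S := lt_of_lt_of_le ha haS
  set W := |x 0| ^ (min (μ - 1) 0) with hW
  have hW0 : 0 ≤ W := by positivity
  have hd : S ^ (μ - 1) ≤ W * (1 + S) ^ M := rpow_dom ha haS M (Nat.le_ceil _)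
  have hlf : |lf ξ x| ≤ K * S := lf_abs_le ξ x
  have hT1 : 1 ≤ 1 + S := by linarith
  have hlfk : ∀ m, m ≤ k → |lf ξ x| ^ m ≤ K ^ m * (1 + S) ^ k := fun m hm =>
    calc |lf ξ x| ^ m ≤ (K * S) ^ m := pow_le_pow_left₀ (abs_nonneg _) hlf m
      _ = K ^ m * S ^ m := mul_pow _ _ _
      _ ≤ K ^ m * (1 + S) ^ m := by gcongr; linarith
      _ ≤ K ^ m * (1 + S) ^ k := by gcongr
  have hp : |pd i u x| ≤ C1 * (W * (1 + S) ^ (M+1)) := by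
    refine (hC1 x hx i).trans (mul_le_mul_of_nonneg_left (hd.trans ?_) hC10)
    gcongr
    omega
  have hu' : |u x| ≤ C2 * (W * (1 + S) ^ (M+1)) := by
    refine (hC2 x).trans (mul_le_mul_of_nonneg_left ?_ hC20)
    have : S ^ μ = S ^ (μ - 1) * S := by
      rw [Real.rpow_sub hSp, Real.rpow_one]; field_simp
    rw [← hS, this, pow_succ, ← mul_assoc]
    exact mul_le_mul hd (by linarith) hSp.le (by positivity)
  have hξ : |ξ i| ≤ K := Finset.single_le_sum (f := fun i => |ξ i|) (fun i _ => abs_nonneg _) (Finset.mem_univ i)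
  have h3 := hC3 x
  rw [zero_mul, Real.exp_zero, mul_one] at h3
  have hg := gw_pos x
  calc |flux u ξ k i x| = gw x * |lf ξ x ^ k * pd i u x - u x * (lf ξ x ^ (k-1) * (k * ξ i))| := by
        rw [flux, abs_mul, abs_of_pos hg]
    _ ≤ gw x * (|lf ξ x| ^ k * |pd i u x| + |u x| * (|lf ξ x| ^ (k-1) * (k * |ξ i|))) := by
        refine mul_le_mul_of_nonneg_left ((abs_sub _ _).trans (le_of_eq ?_)) hg.le
        simp [abs_mul, abs_pow]
    _ ≤ gw x * ((K ^ k * (1 + S) ^ k) * (C1 * (W * (1 + S) ^ (M+1))) +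
          (C2 * (W * (1 + S) ^ (M+1))) * ((K ^ (k-1) * (1 + S) ^ k) * (k * K))) := by
        have h1 := hlfk k le_rfl
        have h2 := hlfk (k-1) (by omega)
        refine mul_le_mul_of_nonneg_left (add_le_add ?_ ?_) hg.le
        · exact mul_le_mul h1 hp (abs_nonneg _) (by positivity)
        · refine mul_le_mul hu' ?_ (by positivity) (by positivity)
          exact mul_le_mul h2 (by gcongr) (by positivity) (by positivity)
    _ = E * W * ((1 + S) ^ (M + k + 1) * gw x) := by rw [hE]; ring
    _ ≤ E * W * (C3 * Real.exp (-(qs x) / 4)) := mul_le_mul_of_nonneg_left h3 (by positivity)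
    _ = E * C3 * bf (min (μ - 1) 0) x := by rw [bf]; ring

lemma qs_ins {d : ℕ} (t : ℝ) (y : Fin (d+1) → ℝ) : qs (ins t y) = qs y + t ^ 2 := by
  simp only [qs]
  rw [Fin.sum_univ_castSucc]
  simp only [ins_last, ins_castSucc]

lemma ins_at_zero {d : ℕ} (t : ℝ) (y : Fin (d+1) → ℝ) : ins t y 0 = y 0 := ins_castSucc t y 0

lemma bf_ins_le {d : ℕ} (α t : ℝ) (y : Fin (d+1) → ℝ) : bf α (ins t y) ≤ bf α y := by
  rw [bf, bf, ins_at_zero, qs_ins]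
  refine mul_le_mul_of_nonneg_left (Real.exp_le_exp.2 ?_) (by positivity)
  nlinarith [sq_nonneg t]

/-- the boundary flux -/
noncomputable def flux0 {d : ℕ} (u : (Fin (d + 2) → ℝ) → ℝ)
    (G : (Fin (d + 2) → ℝ) → Fin (d + 2) → ℝ) (ξ : Fin (d+2) → ℝ) (k : ℕ)
    (y : Fin (d+1) → ℝ) : ℝ :=
  gw (ins 0 y) * (lf ξ (ins 0 y) ^ k * G (ins 0 y) (Fin.last (d+1)) -
    u (ins 0 y) * (lf ξ (ins 0 y) ^ (k-1) * (k * ξ (Fin.last (d+1)))))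

lemma ae_zero_ne (n : ℕ) : ∀ᵐ y : Fin (n+1) → ℝ, y 0 ≠ 0 :=
  Measure.ae_eval_ne (fun _ => volume) 0 0

lemma flux_tendsto {d : ℕ} {μ : ℝ} {u : (Fin (d + 2) → ℝ) → ℝ}
    (hu : IsTOPSol μ u (Fin.last (d + 1)))
    (G : (Fin (d + 2) → ℝ) → Fin (d + 2) → ℝ)
    (hGcont : ContinuousOn G ({x : Fin (d + 2) → ℝ | 0 ≤ x (Fin.last (d + 1))} \ {0}))
    (hGgrad : ∀ x : Fin (d + 2) → ℝ, 0 < x (Fin.last (d + 1)) →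
      ∀ i : Fin (d + 2), G x i = pd i u x) (ξ : Fin (d+2) → ℝ) (k : ℕ)
    (y : Fin (d+1) → ℝ) (hy : y 0 ≠ 0) :
    Tendsto (fun t => flux u ξ k (Fin.last (d+1)) (ins t y)) (nhdsWithin 0 (Set.Ioi 0))
      (nhds (flux0 u G ξ k y)) := by
  have hy0 : y ≠ 0 := fun h => hy (by rw [h]; rfl)
  have hG := G_tendsto G hGcont hy0 (Fin.last (d+1))
  have hi : Tendsto (fun t => ins t y) (nhdsWithin 0 (Set.Ioi 0)) (nhds (ins 0 y)) :=
    ((ins_cont.comp (continuous_id.prodMk continuous_const)).tendsto (0:ℝ)).mono_left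
        nhdsWithin_le_nhds
  have h1 := (gw_cont.tendsto (ins 0 y)).comp hi
  have h2 := ((lf_cont ξ).tendsto (ins 0 y)).comp hi
  have h3 := (hu.cont.tendsto (ins 0 y)).comp hi
  have := h1.mul (((h2.pow k).mul hG).sub (h3.mul ((h2.pow (k-1)).mul_const (k * ξ (Fin.last (d+1))))))
  refine this.congr' ?_
  filter_upwards [self_mem_nhdsWithin] with t ht
  have hx : 0 < ins t y (Fin.last (d+1)) := by rw [ins_last]; exact ht
  simp only [Function.comp, flux, hGgrad _ hx]

lemma flux0_bound {d : ℕ} {μ : ℝ} (hμ : 0 < μ) {u : (Fin (d + 2) → ℝ) → ℝ}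
    (hu : IsTOPSol μ u (Fin.last (d + 1)))
    (G : (Fin (d + 2) → ℝ) → Fin (d + 2) → ℝ)
    (hGcont : ContinuousOn G ({x : Fin (d + 2) → ℝ | 0 ≤ x (Fin.last (d + 1))} \ {0}))
    (hGgrad : ∀ x : Fin (d + 2) → ℝ, 0 < x (Fin.last (d + 1)) →
      ∀ i : Fin (d + 2), G x i = pd i u x) (ξ : Fin (d+2) → ℝ) (k : ℕ) :
    ∃ C, 0 ≤ C ∧ ∀ y : Fin (d+1) → ℝ, y 0 ≠ 0 → |flux0 u G ξ k y| ≤ C * bf (min (μ - 1) 0) y := by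
  obtain ⟨C, hC0, hC⟩ := flux_bound hμ hu G hGcont hGgrad ξ k
  refine ⟨C, hC0, fun y hy => ?_⟩
  refine le_of_tendsto (flux_tendsto hu G hGcont hGgrad ξ k y hy).abs ?_
  filter_upwards [self_mem_nhdsWithin] with t ht
  have hx : ins t y ∈ hsp d := by simpa [hsp, ins_last] using ht
  exact (hC _ _ hx (by rwa [ins_at_zero])).trans
    (mul_le_mul_of_nonneg_left (bf_ins_le _ _ _) hC0)

lemma mom_identity {d : ℕ} {μ : ℝ} (hμ : 0 < μ) {u : (Fin (d + 2) → ℝ) → ℝ}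
    (hu : IsTOPSol μ u (Fin.last (d + 1)))
    (G : (Fin (d + 2) → ℝ) → Fin (d + 2) → ℝ)
    (hGcont : ContinuousOn G ({x : Fin (d + 2) → ℝ | 0 ≤ x (Fin.last (d + 1))} \ {0}))
    (hGgrad : ∀ x : Fin (d + 2) → ℝ, 0 < x (Fin.last (d + 1)) →
      ∀ i : Fin (d + 2), G x i = pd i u x) (ξ : Fin (d+2) → ℝ) (k : ℕ) :
    (k - μ) * mom u ξ k - (k * (k-1 : ℕ) * qs ξ) * mom u ξ (k-2) = - ∫ y, flux0 u G ξ k y := by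
  obtain ⟨C, hC0, hC⟩ := flux_bound hμ hu G hGcont hGgrad ξ k
  have hα : -1 < min (μ - 1) 0 := lt_min (by linarith) (by norm_num)
  have i1 := ((mom_integrable hμ hu ξ k).integrableOn (s := hsp d)).const_mul (k - μ)
  have i2 := ((mom_integrable hμ hu ξ (k-2)).integrableOn (s := hsp d)).const_mul
    (k * (k-1 : ℕ) * qs ξ)
  rw [← div_lemma (flux u ξ k) _ (fun x => C * bf (min (μ - 1) 0) x) (flux0 u G ξ k)
    (fun x => C * bf (min (μ - 1) 0) x) (flux_contDiffOn hu ξ k) (flux_div hu ξ k)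
    (i1.sub i2) ((integrable_bf _ hα).const_mul C) ?_ ((integrable_bf _ hα).const_mul C) ?_ ?_]
  · rw [integral_sub i1 i2, integral_const_mul, integral_const_mul]
    rfl
  · intro i
    filter_upwards [ae_zero_ne (d+1)] with x hx hx2 using hC i x hx2 hx
  · filter_upwards [ae_zero_ne d] with y hy t ht
    have hx : ins t y ∈ hsp d := by simpa [hsp, ins_last] using ht
    exact (hC _ _ hx (by rwa [ins_at_zero])).trans
      (mul_le_mul_of_nonneg_left (bf_ins_le _ _ _) hC0)
  · filter_upwards [ae_zero_ne d] with y hy using flux_tendsto hu G hGcont hGgrad ξ k y hy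

/-- If all but finitely many terms of an alternating-type series have one sign and the sum
stays bounded, then all high order coefficients vanish. -/
lemma growth {a : ℕ → ℝ} {N : ℕ} {B : ℝ} (hpos : ∀ k, N ≤ k → 0 ≤ a k)
    (F : ℝ → ℝ) (hF : ∀ s, 0 ≤ s → HasSum (fun k => a k * s ^ k) (F s))
    (hB : ∀ s, 0 ≤ s → F s ≤ B) (M : ℕ) (hM : N < M) : a M = 0 := by
  set A := ∑ k ∈ Finset.range N, |a k| with hA
  have key : ∀ s : ℝ, 1 ≤ s → a M * s ≤ A + |B| := by
    intro s hs
    have h1 : ∑ k ∈ insert M (Finset.range N), a k * s ^ k ≤ F s := by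
      refine sum_le_hasSum _ (fun k hk => ?_) (hF s (by linarith))
      simp only [Finset.mem_insert, Finset.mem_range, not_or, not_lt] at hk
      exact mul_nonneg (hpos k hk.2) (by positivity)
    rw [Finset.sum_insert (by simp; omega)] at h1
    have h2 : -(A * s ^ N) ≤ ∑ k ∈ Finset.range N, a k * s ^ k := by
      rw [hA, Finset.sum_mul, ← Finset.sum_neg_distrib]
      refine Finset.sum_le_sum fun k hk => ?_
      have hk' := Finset.mem_range.1 hk
      have h3 : s ^ k ≤ s ^ N := pow_le_pow_right₀ hs hk'.le
      have h4 : |a k| * s ^ k ≤ |a k| * s ^ N := mul_le_mul_of_nonneg_left h3 (abs_nonneg _)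
      have h5 : -|a k| * s ^ k ≤ a k * s ^ k :=
        mul_le_mul_of_nonneg_right (neg_abs_le _) (by positivity)
      linarith
    have h3 := hB s (by linarith)
    have hsN : 1 ≤ s ^ N := one_le_pow₀ hs
    have h4 : a M * s * s ^ N ≤ a M * s ^ M := by
      rw [mul_assoc, ← pow_succ']
      exact mul_le_mul_of_nonneg_left (pow_le_pow_right₀ hs hM) (hpos M hM.le)
    have h5 : |B| ≤ |B| * s ^ N := le_mul_of_one_le_right (abs_nonneg _) hsN
    have h6 : a M * s * s ^ N ≤ (A + |B|) * s ^ N := by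
      have := le_abs_self B
      linarith
    exact le_of_mul_le_mul_right h6 (by linarith)
  by_contra h0
  have hp : 0 < a M := lt_of_le_of_ne (hpos M hM.le) (Ne.symm h0)
  have hA0 : 0 ≤ A := Finset.sum_nonneg fun i _ => abs_nonneg _
  have := key ((A + |B|) / a M + 1) (by have := abs_nonneg B; have : 0 ≤ (A + |B|) / a M := by positivity
                                        linarith)
  rw [mul_add, mul_div_cancel₀ _ hp.ne'] at this
  linarith

lemma sign_even {L : ℕ → ℝ} {μ : ℝ} {j : ℕ} (hμ1 : (2 * j : ℝ) < μ)
    (h0 : L 0 ≤ 0) (hr : ∀ k : ℕ, ((k + 2 : ℕ) - μ) * L (k + 2) = (k + 2 : ℕ) * (k + 1 : ℕ) * L k) :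
    ∀ i ≤ j, (-1) ^ i * L (2 * i) ≤ 0 := by
  intro i
  induction i with
  | zero => intro _; simpa using h0
  | succ i ih =>
    intro hi
    have h1 := ih (by omega)
    have h2 := hr (2 * i)
    have h3 : ((2 * i + 2 : ℕ) : ℝ) - μ < 0 := by
      have : ((i + 1 : ℕ) : ℝ) ≤ j := by exact_mod_cast hi
      push_cast at this ⊢
      linarith
    have h4 : 0 < ((2 * i + 2 : ℕ) : ℝ) * (2 * i + 1 : ℕ) := by positivity
    have h5 : (((2 * i + 2 : ℕ) : ℝ) - μ) * ((-1) ^ (i+1) * L (2 * (i + 1))) =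
        - (((2 * i + 2 : ℕ) : ℝ) * (2 * i + 1 : ℕ)) * ((-1) ^ i * L (2 * i)) := by
      rw [show 2 * (i + 1) = 2 * i + 2 by ring, pow_succ]
      linear_combination (-(-1) ^ i) * h2
    by_contra hc
    push Not at hc
    nlinarith [mul_pos_of_neg_of_neg h3 (neg_neg_of_pos hc), mul_nonneg h4.le (neg_nonneg.2 h1)]

lemma sign_odd {L : ℕ → ℝ} {μ : ℝ} {j : ℕ} (hμ1 : (2 * j : ℝ) < μ)
    (h0 : 0 ≤ (1 - μ) * L 1) (hr : ∀ k : ℕ, ((k + 2 : ℕ) - μ) * L (k + 2) = (k + 2 : ℕ) * (k + 1 : ℕ) * L k) :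
    ∀ i ≤ j, 0 ≤ (-1) ^ i * ((2 * i + 1 : ℕ) - μ) * L (2 * i + 1) := by
  intro i
  induction i with
  | zero => intro _; simpa using h0
  | succ i ih =>
    intro hi
    have h1 := ih (by omega)
    have h2 := hr (2 * i + 1)
    have h3 : ((2 * i + 1 : ℕ) : ℝ) - μ < 0 := by
      have : ((i + 1 : ℕ) : ℝ) ≤ j := by exact_mod_cast hi
      push_cast at this ⊢
      linarith
    have h5 : (-1) ^ i * L (2 * i + 1) ≤ 0 := by
      by_contra hc
      push Not at hc
      nlinarith [mul_pos_of_neg_of_neg h3 (neg_neg_of_pos hc)]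
    have h4 : 0 < ((2 * i + 1 + 2 : ℕ) : ℝ) * (2 * i + 1 + 1 : ℕ) := by positivity
    rw [show 2 * (i + 1) + 1 = 2 * i + 1 + 2 by ring, mul_assoc, h2, pow_succ]
    nlinarith [mul_nonneg h4.le (neg_nonneg.2 h5)]

lemma sign_all {L : ℕ → ℝ} {μ : ℝ} {j : ℕ} (hμ1 : (2 * j : ℝ) < μ) (hμ2 : μ < 2 * j + 1)
    (h0 : L 0 ≤ 0) (h1 : 0 ≤ (1 - μ) * L 1)
    (hr : ∀ k : ℕ, ((k + 2 : ℕ) - μ) * L (k + 2) = (k + 2 : ℕ) * (k + 1 : ℕ) * L k) :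
    ∀ m, 0 ≤ -(-1) ^ j * ((-1) ^ (2 * j + m) * L (2 * j + m)) := by
  intro m
  induction m using Nat.strong_induction_on with
  | _ m ih =>
    rcases m with _ | _ | m
    · have := sign_even hμ1 h0 hr j le_rfl
      rw [add_zero, pow_mul]; norm_num
      linarith
    · have := sign_odd hμ1 h1 hr j le_rfl
      have h3 : 0 < ((2 * j + 1 : ℕ) : ℝ) - μ := by push_cast; linarith
      have h4 : 0 ≤ (-1) ^ j * L (2 * j + 1) := by
        by_contra hc
        push Not at hc
        nlinarith [mul_pos h3 (neg_pos.2 hc)]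
      rw [zero_add, pow_add, pow_mul]; norm_num
      linarith
    · have h := ih m (by omega)
      have h2 := hr (2 * j + m)
      have h3 : 0 < ((2 * j + m + 2 : ℕ) : ℝ) - μ := by push_cast; linarith
      have h4 : 0 < ((2 * j + m + 2 : ℕ) : ℝ) * (2 * j + m + 1 : ℕ) := by positivity
      have h5 : (((2 * j + m + 2 : ℕ) : ℝ) - μ) *
          (-(-1) ^ j * ((-1) ^ (2 * j + (m + 1 + 1)) * L (2 * j + (m + 1 + 1)))) =
          (((2 * j + m + 2 : ℕ) : ℝ) * (2 * j + m + 1 : ℕ)) *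
            (-(-1) ^ j * ((-1) ^ (2 * j + m) * L (2 * j + m))) := by
        rw [show 2 * j + (m + 1 + 1) = 2 * j + m + 2 by ring, pow_add (-1 : ℝ) (2 * j + m) 2]
        linear_combination (-(-1) ^ j * (-1) ^ (2 * j + m)) * h2
      have h6 := mul_nonneg h4.le h
      rw [← h5] at h6
      exact nonneg_of_mul_nonneg_right h6 h3

lemma mom_series {d : ℕ} {μ : ℝ} (hμ : 0 < μ) {u : (Fin (d + 2) → ℝ) → ℝ}
    (hu : IsTOPSol μ u (Fin.last (d + 1))) (ξ : Fin (d+2) → ℝ) (c : ℂ) :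
    HasSum (fun k : ℕ => c ^ k / k.factorial * (mom u ξ k : ℂ))
      (∫ x in hsp d, ((u x * gw x : ℝ) : ℂ) * Complex.exp (c * (lf ξ x : ℂ))) := by
  have hK : 0 ≤ ‖c‖ * ∑ i, |ξ i| :=
    mul_nonneg (norm_nonneg _) (Finset.sum_nonneg fun i _ => abs_nonneg _)
  have hbs : ∀ x : Fin (d+2) → ℝ, HasSum (fun n : ℕ => |u x| * gw x * ((‖c‖ * |lf ξ x|) ^ n / n.factorial))
      (|u x| * gw x * Real.exp (‖c‖ * |lf ξ x|)) := fun x => by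
    have := NormedSpace.expSeries_div_hasSum_exp (𝔸 := ℝ) (‖c‖ * |lf ξ x|)
    rw [← Real.exp_eq_exp_ℝ] at this
    exact this.mul_left _
  have h := hasSum_integral_of_dominated_convergence (μ := volume.restrict (hsp d))
    (F := fun (k : ℕ) x => c ^ k / k.factorial * ((u x * lf ξ x ^ k * gw x : ℝ) : ℂ))
    (f := fun x => ((u x * gw x : ℝ) : ℂ) * Complex.exp (c * (lf ξ x : ℂ)))
    (fun n x => |u x| * gw x * ((‖c‖ * |lf ξ x|) ^ n / n.factorial)) ?_ ?_ ?_ ?_ ?_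
  · refine h.congr_fun ?_ |> id
    intro k
    rw [integral_const_mul, integral_complex_ofReal, mom]
  · intro k
    refine Continuous.aestronglyMeasurable ?_
    exact continuous_const.mul (Complex.continuous_ofReal.comp
      ((hu.cont.mul ((lf_cont ξ).pow k)).mul gw_cont))
  · intro k
    refine ae_of_all _ fun x => le_of_eq ?_
    rw [norm_mul, Complex.norm_real, norm_div, norm_pow, Real.norm_eq_abs, abs_mul, abs_mul,
      abs_pow, abs_of_pos (gw_pos x), mul_pow]
    simp
    ring
  · exact ae_of_all _ fun x => (hbs x).summable
  · have e : (fun x => ∑' n : ℕ, |u x| * gw x * ((‖c‖ * |lf ξ x|) ^ n / n.factorial)) =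
        fun x => |u x| * gw x * Real.exp (‖c‖ * |lf ξ x|) := funext fun x => (hbs x).tsum_eq
    rw [e]
    refine (Integrable.mono' (u_exp_integrable hμ hu _ hK) ?_ ?_).integrableOn
    · exact ((hu.cont.abs.mul gw_cont).mul (Real.continuous_exp.comp
        (continuous_const.mul (lf_cont ξ).abs))).aestronglyMeasurable
    · refine ae_of_all _ fun x => ?_
      have hg := gw_pos x
      rw [Real.norm_eq_abs, abs_of_nonneg (by positivity), mul_right_comm]
      refine mul_le_mul_of_nonneg_right (mul_le_mul_of_nonneg_left (Real.exp_le_exp.2 ?_)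
        (abs_nonneg _)) hg.le
      rw [mul_assoc]
      exact mul_le_mul_of_nonneg_left (lf_abs_le ξ x) (norm_nonneg _)
  · refine ae_of_all _ fun x => ?_
    have := NormedSpace.expSeries_div_hasSum_exp (𝔸 := ℂ) (c * (lf ξ x : ℂ))
    rw [← Complex.exp_eq_exp_ℂ] at this
    refine (this.mul_left ((u x * gw x : ℝ) : ℂ)).congr_fun ?_ |> id
    intro k
    push_cast
    rw [mul_pow]
    ring

lemma mom_series_real {d : ℕ} {μ : ℝ} (hμ : 0 < μ) {u : (Fin (d + 2) → ℝ) → ℝ}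
    (hu : IsTOPSol μ u (Fin.last (d + 1))) (ξ : Fin (d+2) → ℝ) (s : ℝ) :
    HasSum (fun k : ℕ => s ^ k / k.factorial * mom u ξ k)
      (∫ x in hsp d, u x * gw x * Real.exp (s * lf ξ x)) := by
  have h := mom_series hμ hu ξ (s : ℂ)
  rw [← Complex.hasSum_ofReal]
  have e : (∫ x in hsp d, ((u x * gw x : ℝ) : ℂ) * Complex.exp ((s:ℂ) * (lf ξ x : ℂ))) =
      ((∫ x in hsp d, u x * gw x * Real.exp (s * lf ξ x) : ℝ) : ℂ) := by
    rw [← integral_complex_ofReal]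
    congr 1
    ext x
    push_cast
    rfl
  rw [e] at h
  refine h.congr_fun ?_ |> id
  intro k
  push_cast
  rfl

lemma flux0_integrable {d : ℕ} {μ : ℝ} (hμ : 0 < μ) {u : (Fin (d + 2) → ℝ) → ℝ}
    (hu : IsTOPSol μ u (Fin.last (d + 1)))
    (G : (Fin (d + 2) → ℝ) → Fin (d + 2) → ℝ)
    (hGcont : ContinuousOn G ({x : Fin (d + 2) → ℝ | 0 ≤ x (Fin.last (d + 1))} \ {0}))
    (hGgrad : ∀ x : Fin (d + 2) → ℝ, 0 < x (Fin.last (d + 1)) →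
      ∀ i : Fin (d + 2), G x i = pd i u x) (ξ : Fin (d+2) → ℝ) (k : ℕ) :
    Integrable (flux0 u G ξ k) := by
  obtain ⟨C, hC0, hC⟩ := flux0_bound hμ hu G hGcont hGgrad ξ k
  have hα : -1 < min (μ - 1) 0 := lt_min (by linarith) (by norm_num)
  refine Integrable.mono' ((integrable_bf (n := d) _ hα).const_mul C) ?_ ?_
  · have hs : MeasurableSet {y : Fin (d+1) → ℝ | y 0 ≠ 0} :=
      (measurable_pi_apply 0) (measurableSet_singleton 0).compl
    have hres : (volume : Measure (Fin (d+1) → ℝ)).restrict {y : Fin (d+1) → ℝ | y 0 ≠ 0} = volume :=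
      Measure.restrict_eq_self_of_ae_mem (ae_zero_ne d)
    rw [← hres]
    refine ContinuousOn.aestronglyMeasurable ?_ hs
    have hi : Continuous (fun y : Fin (d+1) → ℝ => ins 0 y) :=
      ins_cont.comp (continuous_const.prodMk continuous_id)
    have hG : ContinuousOn (fun y : Fin (d+1) → ℝ => G (ins 0 y) (Fin.last (d+1)))
        {y : Fin (d+1) → ℝ | y 0 ≠ 0} := by
      refine (continuous_apply _).comp_continuousOn (hGcont.comp hi.continuousOn ?_)
      intro y hy
      have hy0 : y ≠ 0 := fun h => hy (by rw [h]; rfl)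
      exact ⟨by simp [ins_last], ins_zero_ne hy0 0⟩
    have h1 := (gw_cont.comp hi).continuousOn (s := {y : Fin (d+1) → ℝ | y 0 ≠ 0})
    have h2 := ((lf_cont ξ).comp hi).continuousOn (s := {y : Fin (d+1) → ℝ | y 0 ≠ 0})
    have h3 := (hu.cont.comp hi).continuousOn (s := {y : Fin (d+1) → ℝ | y 0 ≠ 0})
    exact h1.mul (((h2.pow k).mul hG).sub (h3.mul ((h2.pow (k-1)).mul continuousOn_const)))
  · filter_upwards [ae_zero_ne d] with y hy using hC y hy

/-- last basis vector -/
def eN (d : ℕ) : Fin (d+2) → ℝ := Pi.single (Fin.last (d+1)) 1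

lemma lf_eN {d : ℕ} (x : Fin (d+2) → ℝ) : lf (eN d) x = x (Fin.last (d+1)) := by
  simp [lf, eN, Pi.single_apply]

lemma qs_eN (d : ℕ) : qs (eN d) = 1 := by
  simp [qs, eN, Pi.single_apply]

lemma step_one {d : ℕ} {j : ℕ} {μ : ℝ} (hμ1 : (2 * j : ℝ) < μ) (hμ2 : μ < 2 * j + 1)
    {u : (Fin (d + 2) → ℝ) → ℝ}
    (hu : IsTOPSol μ u (Fin.last (d + 1)))
    (G : (Fin (d + 2) → ℝ) → Fin (d + 2) → ℝ)
    (hGcont : ContinuousOn G ({x : Fin (d + 2) → ℝ | 0 ≤ x (Fin.last (d + 1))} \ {0}))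
    (hGgrad : ∀ x : Fin (d + 2) → ℝ, 0 < x (Fin.last (d + 1)) →
      ∀ i : Fin (d + 2), G x i = pd i u x) :
    ∀ᵐ y : Fin (d+1) → ℝ, u (ins 0 y) = 0 ∧ G (ins 0 y) (Fin.last (d+1)) = 0 := by
  have hμ : 0 < μ := lt_of_le_of_lt (by positivity) hμ1
  set L : ℕ → ℝ := mom u (eN d) with hL
  have hid := fun k => mom_identity hμ hu G hGcont hGgrad (eN d) k
  have hf0 : ∀ y, flux0 u G (eN d) 0 y = gw (ins 0 y) * G (ins 0 y) (Fin.last (d+1)) := by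
    intro y; simp [flux0]
  have hf1 : ∀ y, flux0 u G (eN d) 1 y = -(gw (ins 0 y) * u (ins 0 y)) := by
    intro y
    have e : eN d (Fin.last (d+1)) = 1 := by simp [eN]
    simp [flux0, lf_eN, ins_last, e]
  have hf2 : ∀ k y, flux0 u G (eN d) (k+2) y = 0 := by
    intro k y; simp [flux0, lf_eN, ins_last]
  have hf0n : ∀ᵐ y, 0 ≤ -flux0 u G (eN d) 0 y := by
    filter_upwards [ae_zero_ne d] with y hy
    have hy0 : y ≠ 0 := fun h => hy (by rw [h]; rfl)
    rw [hf0]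
    have := G_nonpos hu G hGcont hGgrad hy0
    have := gw_pos (ins 0 y)
    nlinarith
  have hf1n : ∀ᵐ y, 0 ≤ -flux0 u G (eN d) 1 y := by
    refine ae_of_all _ fun y => ?_
    rw [hf1, neg_neg]
    exact mul_nonneg (gw_pos _).le (hu.nonneg _ (ins_last 0 y))
  have h0 : (0 - μ) * L 0 = ∫ y, -flux0 u G (eN d) 0 y := by
    rw [integral_neg, ← hid 0]; simp [hL]
  have h1 : (1 - μ) * L 1 = ∫ y, -flux0 u G (eN d) 1 y := by
    rw [integral_neg, ← hid 1]; simp [hL]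
  have hr : ∀ k : ℕ, ((k + 2 : ℕ) - μ) * L (k + 2) = (k + 2 : ℕ) * (k + 1 : ℕ) * L k := by
    intro k
    have := hid (k+2)
    simp only [hf2, integral_zero, neg_zero, qs_eN, mul_one, Nat.add_sub_cancel] at this
    rw [show k + 2 - 1 = k + 1 by omega] at this
    linarith
  have hL0 : L 0 ≤ 0 := by
    have := integral_nonneg_of_ae hf0n
    rw [← h0] at this
    by_contra hc
    push Not at hc
    nlinarith [mul_pos hμ hc]
  have hL1 : 0 ≤ (1 - μ) * L 1 := by
    rw [h1]; exact integral_nonneg_of_ae hf1n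
  have hsign := sign_all hμ1 hμ2 hL0 hL1 hr
  -- boundedness
  have hint : Integrable (fun x => |u x| * gw x) := by
    simpa using u_exp_integrable hμ hu 0 le_rfl
  have hbd : ∀ s : ℝ, 0 ≤ s → -(-1) ^ j * (∫ x in hsp d, u x * gw x * Real.exp ((-s) * lf (eN d) x))
      ≤ ∫ x in hsp d, |u x| * gw x := by
    intro s hs
    have h2 : |∫ x in hsp d, u x * gw x * Real.exp ((-s) * lf (eN d) x)| ≤
        ∫ x in hsp d, |u x| * gw x := by
      rw [← Real.norm_eq_abs]
      refine norm_integral_le_of_norm_le hint.integrableOn ?_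
      filter_upwards [ae_restrict_mem (isOpen_hsp d).measurableSet] with x hx
      have hx' : 0 < x (Fin.last (d+1)) := hx
      rw [Real.norm_eq_abs, abs_mul, abs_mul, abs_of_pos (gw_pos x), Real.abs_exp]
      refine mul_le_of_le_one_right (mul_nonneg (abs_nonneg _) (gw_pos x).le) ?_
      rw [Real.exp_le_one_iff, lf_eN]
      nlinarith
    refine le_trans (le_abs_self _) ?_
    rw [abs_mul, abs_neg, abs_pow, abs_neg, abs_one, one_pow, one_mul]
    exact h2
  have hvan : ∀ M, 2 * j < M → L M = 0 := by
    intro M hM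
    have h := growth (a := fun k => -(-1) ^ j * ((-1) ^ k * L k) / k.factorial) (N := 2 * j)
      (B := ∫ x in hsp d, |u x| * gw x) ?_
      (fun s => -(-1) ^ j * (∫ x in hsp d, u x * gw x * Real.exp ((-s) * lf (eN d) x))) ?_ hbd M hM
    · have h5 : ((M.factorial : ℕ) : ℝ) ≠ 0 := by positivity
      simpa [h5] using h
    · intro k hk
      obtain ⟨m, rfl⟩ := Nat.exists_eq_add_of_le hk
      exact div_nonneg (hsign m) (by positivity)
    · intro s _
      refine ((mom_series_real hμ hu (eN d) (-s)).mul_left (-(-1) ^ j)).congr_fun ?_ |> id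
      intro k
      rw [neg_pow s]
      simp only [hL]
      ring
  have hback : ∀ n m : ℕ, L (m + 2 * n) = 0 → L m = 0 := by
    intro n
    induction n with
    | zero => intro m h; simpa using h
    | succ n ih =>
      intro m h
      apply ih m
      have := hr (m + 2 * n)
      rw [show m + 2 * n + 2 = m + 2 * (n+1) by ring, h, mul_zero] at this
      have h4 : ((m + 2 * (n+1) : ℕ) : ℝ) * (m + 2 * n + 1 : ℕ) ≠ 0 := by positivity
      exact (mul_eq_zero.1 this.symm).resolve_left h4
  have hall : ∀ m, L m = 0 := fun m => hback (j+1) m (hvan _ (by omega))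
  rw [hall 0, mul_zero] at h0
  rw [hall 1, mul_zero] at h1
  have k0 := (integral_eq_zero_iff_of_nonneg_ae hf0n
    (flux0_integrable hμ hu G hGcont hGgrad (eN d) 0).neg).1 h0.symm
  have k1 := (integral_eq_zero_iff_of_nonneg_ae hf1n
    (flux0_integrable hμ hu G hGcont hGgrad (eN d) 1).neg).1 h1.symm
  filter_upwards [k0, k1] with y e0 e1
  have hg := (gw_pos (ins 0 y)).ne'
  simp only [hf0, hf1, Pi.zero_apply, neg_neg, neg_eq_zero, mul_eq_zero, hg, false_or] at e0 e1
  exact ⟨e1, e0⟩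

lemma step_two {d : ℕ} {j : ℕ} {μ : ℝ} (hμ1 : (2 * j : ℝ) < μ) (hμ2 : μ < 2 * j + 1)
    {u : (Fin (d + 2) → ℝ) → ℝ}
    (hu : IsTOPSol μ u (Fin.last (d + 1)))
    (G : (Fin (d + 2) → ℝ) → Fin (d + 2) → ℝ)
    (hGcont : ContinuousOn G ({x : Fin (d + 2) → ℝ | 0 ≤ x (Fin.last (d + 1))} \ {0}))
    (hGgrad : ∀ x : Fin (d + 2) → ℝ, 0 < x (Fin.last (d + 1)) →
      ∀ i : Fin (d + 2), G x i = pd i u x) (ξ : Fin (d+2) → ℝ) (k : ℕ) : mom u ξ k = 0 := by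
  have hμ : 0 < μ := lt_of_le_of_lt (by positivity) hμ1
  have hae := step_one hμ1 hμ2 hu G hGcont hGgrad
  induction k using Nat.strong_induction_on with
  | _ k ih =>
    have h := mom_identity hμ hu G hGcont hGgrad ξ k
    have hz : ∫ y, flux0 u G ξ k y = 0 := by
      rw [← integral_zero (Fin (d+1) → ℝ) ℝ]
      apply integral_congr_ae
      filter_upwards [hae] with y hy
      simp [flux0, hy.1, hy.2]
    have hk : (k : ℝ) - μ ≠ 0 := by
      intro h0
      have e : (k : ℝ) = μ := by linarith
      rw [← e] at hμ1 hμ2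
      have a1 : 2 * j < k := by exact_mod_cast hμ1
      have a2 : k < 2 * j + 1 := by exact_mod_cast hμ2
      omega
    have h2 : (k * (k-1 : ℕ) * qs ξ) * mom u ξ (k-2) = 0 := by
      rcases k with _ | _ | k
      · simp
      · simp
      · rw [ih _ (by omega), mul_zero]
    rw [hz, h2, neg_zero, sub_zero] at h
    exact (mul_eq_zero.1 h).resolve_left hk

lemma fourier_unique {n : ℕ} (f : (Fin n → ℝ) → ℝ) (s : Set (Fin n → ℝ))
    (hf : Measurable f) (hi : IntegrableOn f s)
    (h : ∀ ξ : Fin n → ℝ, ∫ x in s, (f x : ℂ) * Complex.exp (Complex.I * (lf ξ x : ℂ)) = 0) :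
    f =ᵐ[volume.restrict s] 0 := by
  set ν := (volume : Measure (Fin n → ℝ)).restrict s
  have hm1 : Measurable (fun x => ENNReal.ofReal (f x)) := hf.ennreal_ofReal
  have hm2 : Measurable (fun x => ENNReal.ofReal (-f x)) := hf.neg.ennreal_ofReal
  have hi' : Integrable f ν := hi
  have f1 : IsFiniteMeasure (ν.withDensity fun x => ENNReal.ofReal (f x)) :=
    isFiniteMeasure_withDensity_ofReal hi'.2
  have f2 : IsFiniteMeasure (ν.withDensity fun x => ENNReal.ofReal (-f x)) :=
    isFiniteMeasure_withDensity_ofReal hi'.neg.2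
  have heq : (ν.withDensity fun x => ENNReal.ofReal (f x)) =
      ν.withDensity fun x => ENNReal.ofReal (-f x) := by
    apply Measure.ext_of_charFunDual
    ext T
    rw [charFunDual_apply, charFunDual_apply,
      integral_withDensity_eq_integral_toReal_smul hm1 (ae_of_all _ fun _ => ENNReal.ofReal_lt_top),
      integral_withDensity_eq_integral_toReal_smul hm2 (ae_of_all _ fun _ => ENNReal.ofReal_lt_top),
      ← sub_eq_zero]
    have hT : Continuous (fun x => Complex.exp (T x * Complex.I)) := by fun_prop
    have hn : ∀ x, ‖Complex.exp (T x * Complex.I)‖ = 1 := fun x => Complex.norm_exp_ofReal_mul_I _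
    have int : ∀ g : (Fin n → ℝ) → ℝ, Measurable g → Integrable g ν →
        Integrable (fun x => (ENNReal.ofReal (g x)).toReal • Complex.exp (T x * Complex.I)) ν := by
      intro g hg hgi
      refine Integrable.mono' hgi.abs ?_ ?_
      · exact (hg.ennreal_ofReal.ennreal_toReal.smul hT.measurable).aestronglyMeasurable
      · refine ae_of_all _ fun x => ?_
        rw [norm_smul, hn, mul_one, ENNReal.toReal_ofReal', Real.norm_eq_abs,
          abs_of_nonneg (le_max_right _ _)]
        exact max_le (le_abs_self _) (abs_nonneg _)
    rw [← integral_sub (int f hf hi') (int (fun x => -f x) hf.neg hi'.neg)]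
    rw [← h (fun i => T (Pi.single i 1))]
    refine integral_congr_ae (ae_of_all _ fun x => ?_)
    have e : lf (fun i => T (Pi.single i 1)) x = T x := by
      have e : (∑ i, x i • (Pi.single i (1:ℝ) : Fin n → ℝ)) = x := by
        ext j; simp [Finset.sum_apply, Pi.single_apply]
      conv_rhs => rw [← e]
      simp only [map_sum, map_smul, smul_eq_mul, lf]
      exact Finset.sum_congr rfl fun i _ => mul_comm _ _
    simp only [e]
    rw [← sub_smul, ENNReal.toReal_ofReal', ENNReal.toReal_ofReal', max_zero_sub_eq_self,
      Complex.real_smul, mul_comm (T x : ℂ)]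
  have h3 := (withDensity_eq_iff_of_sigmaFinite hm1.aemeasurable hm2.aemeasurable).1 heq
  filter_upwards [h3] with x hx
  simp only [Pi.zero_apply]
  rcases le_total (f x) 0 with h0 | h0
  · rw [ENNReal.ofReal_of_nonpos h0] at hx
    have := ENNReal.ofReal_eq_zero.1 hx.symm
    linarith
  · rw [ENNReal.ofReal_of_nonpos (p := -f x) (by linarith)] at hx
    have := ENNReal.ofReal_eq_zero.1 hx
    linarith

lemma u_zero_upper {d : ℕ} {j : ℕ} {μ : ℝ} (hμ1 : (2 * j : ℝ) < μ) (hμ2 : μ < 2 * j + 1)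
    {u : (Fin (d + 2) → ℝ) → ℝ}
    (hu : IsTOPSol μ u (Fin.last (d + 1)))
    (G : (Fin (d + 2) → ℝ) → Fin (d + 2) → ℝ)
    (hGcont : ContinuousOn G ({x : Fin (d + 2) → ℝ | 0 ≤ x (Fin.last (d + 1))} \ {0}))
    (hGgrad : ∀ x : Fin (d + 2) → ℝ, 0 < x (Fin.last (d + 1)) →
      ∀ i : Fin (d + 2), G x i = pd i u x) : ∀ x ∈ hsp d, u x = 0 := by
  have hμ : 0 < μ := lt_of_le_of_lt (by positivity) hμ1
  have hc : Continuous (fun x => u x * gw x) := hu.cont.mul gw_cont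
  have h := fourier_unique (fun x => u x * gw x) (hsp d) hc.measurable ?_ ?_
  · have h2 := Measure.eqOn_open_of_ae_eq h (isOpen_hsp d) hc.continuousOn continuousOn_const
    intro x hx
    have h3 : u x * gw x = 0 := h2 hx
    exact (mul_eq_zero.1 h3).resolve_right (gw_pos x).ne'
  · have := (mom_integrable hμ hu 0 0).integrableOn (s := hsp d)
    simpa using this
  · intro ξ
    have h2 := mom_series hμ hu ξ Complex.I
    simp only [step_two hμ1 hμ2 hu G hGcont hGgrad ξ, Complex.ofReal_zero, mul_zero] at h2
    exact h2.unique hasSum_zero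

end Helpers

theorem no_solutions_in_even_gaps (d : ℕ) (j : ℕ) (μ : ℝ)
    (hμ1 : (2 * j : ℝ) < μ) (hμ2 : μ < 2 * j + 1)
    (u : (Fin (d + 2) → ℝ) → ℝ) (hu : IsTOPSol μ u (Fin.last (d + 1)))
    (G : (Fin (d + 2) → ℝ) → Fin (d + 2) → ℝ)
    (hGcont : ContinuousOn G ({x : Fin (d + 2) → ℝ | 0 ≤ x (Fin.last (d + 1))} \ {0}))
    (hGgrad : ∀ x : Fin (d + 2) → ℝ, 0 < x (Fin.last (d + 1)) →
      ∀ i : Fin (d + 2), G x i = pd i u x) :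
    ∀ x, u x = 0 := by
  have hup := u_zero_upper hμ1 hμ2 hu G hGcont hGgrad
  intro x
  rcases lt_trichotomy (x (Fin.last (d+1))) 0 with h | h | h
  · rw [← hu.symm x]
    apply hup
    show 0 < Function.update x (Fin.last (d+1)) (-(x (Fin.last (d+1)))) (Fin.last (d+1))
    rw [Function.update_self]
    linarith
  · have h1 : Tendsto (fun t : ℝ => u (x + t • (Pi.single (Fin.last (d+1)) 1 : Fin (d+2) → ℝ)))
        (nhdsWithin 0 (Set.Ioi 0)) (nhds (u x)) := by
      have hc : Continuous (fun t : ℝ => u (x + t • (Pi.single (Fin.last (d+1)) 1 : Fin (d+2) → ℝ))) :=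
        hu.cont.comp (continuous_const.add (continuous_id.smul continuous_const))
      have := (hc.tendsto 0).mono_left (nhdsWithin_le_nhds (s := Set.Ioi (0:ℝ)))
      simpa using this
    have h2 : Tendsto (fun t : ℝ => u (x + t • (Pi.single (Fin.last (d+1)) 1 : Fin (d+2) → ℝ)))
        (nhdsWithin 0 (Set.Ioi 0)) (nhds 0) := by
      refine tendsto_const_nhds.congr' ?_
      filter_upwards [self_mem_nhdsWithin] with t ht
      refine (hup _ ?_).symm
      show 0 < (x + t • (Pi.single (Fin.last (d+1)) 1 : Fin (d+2) → ℝ)) (Fin.last (d+1))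
      have ht' : 0 < t := ht
      simpa [h] using ht'
    exact tendsto_nhds_unique h1 h2
  · exact hup x h
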